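/- arXiv:2512.01779 — 6 statements merged into one kernel-verified Lean document; each statement's English description precedes it below -/
import Mathlib

section
/- Let q > 1 and let χ be a primitive, real, even Dirichlet character of conductor q (i.e. χ is primitive, χ(-1) = 1, and all values of χ are real) with the positive mean property: ∑_{j=0}^{m} χ(j) ≥ 0 for every integer m with 0 ≤ m ≤ q/2. Then: (i) for every integer n ≥ 1 and every real t ≥ 0, ∑_{j=1}^{qn−1} χ(j)·e^{−4t sin²(πj/(qn))} ≥ 0 (the sum being real since χ is real); (ii) the Gauss sum τ(χ) := ∑_{j=1}^{q} χ(j)·e^{2πij/q} equals √q; and (iii) L(s,χ) is a positive real number for every real s with 0 < s < 1. -/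
open Finset

/-- The cumulative sums of a sequence, including the term of index `m`. -/
def cumSum (x : ℕ → ℝ) (m : ℕ) : ℝ := ∑ j ∈ range (m + 1), x j

lemma cumSum_zero (x : ℕ → ℝ) : cumSum x 0 = x 0 := by simp [cumSum]

lemma cumSum_succ (x : ℕ → ℝ) (m : ℕ) : cumSum x (m + 1) = cumSum x m + x (m + 1) := by
  simp [cumSum, sum_range_succ]

/-- Periodic even sequences of mean zero whose cumulative sums are nonnegative on the first
half-period. -/
structure PositiveMean (q : ℕ) (x : ℕ → ℝ) : Prop where
  one_lt : 1 < q
  map_zero : x 0 = 0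
  periodic : ∀ a, x (a + q) = x a
  map_sub : ∀ a ≤ q, x (q - a) = x a
  cumSum_last : cumSum x (q - 1) = 0
  cumSum_nonneg : ∀ m, 2 * m ≤ q → 0 ≤ cumSum x m

lemma sum_mul_eq_sum_cumSum_mul (x f : ℕ → ℝ) (M : ℕ) :
    ∑ a ∈ range M, x a * f a =
      ∑ a ∈ range M, cumSum x a * (f a - f (a + 1)) + (cumSum x M - x M) * f M := by
  induction M with
  | zero => simp [cumSum]
  | succ M ih => rw [sum_range_succ, sum_range_succ, ih, cumSum_succ]; ring

namespace PositiveMean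

variable {q : ℕ} {x : ℕ → ℝ}

lemma cumSum_reflect (h : PositiveMean q x) {a : ℕ} (ha : a < q) :
    cumSum x (q - 1 - a) = -cumSum x a := by
  induction a with
  | zero => simp [cumSum_zero, h.map_zero, h.cumSum_last]
  | succ a ih =>
    have h1 := cumSum_succ x (q - 1 - (a + 1))
    rw [show q - 1 - (a + 1) + 1 = q - (a + 1) by omega, h.map_sub _ ha.le,
      show q - (a + 1) = q - 1 - a by omega, ih (by omega)] at h1
    rw [cumSum_succ]
    linarith

lemma cumSum_add_period (h : PositiveMean q x) (a : ℕ) : cumSum x (a + q) = cumSum x a := by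
  have hq := h.one_lt
  induction a with
  | zero =>
    have h1 := cumSum_succ x (q - 1)
    have h2 := h.periodic 0
    rw [h.cumSum_last, show q - 1 + 1 = q by omega] at h1
    rw [zero_add] at h2
    rw [cumSum_zero, zero_add, h1, h2, zero_add]
  | succ a ih =>
    rw [show a + 1 + q = a + q + 1 by omega, cumSum_succ, cumSum_succ, ih,
      show a + q + 1 = a + 1 + q by omega, h.periodic]

lemma five_le (h : PositiveMean q x) (h1 : x 1 = 1) : 5 ≤ q := by
  have hq := h.one_lt
  have hr := h.cumSum_reflect hq
  have hc : cumSum x 1 = 1 := by rw [cumSum_succ, cumSum_zero, h.map_zero, h1, zero_add]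
  rw [hc] at hr
  by_contra! hlt
  interval_cases q
  · norm_num [cumSum_zero, h.map_zero] at hr
  · norm_num [hc] at hr
  · have := h.cumSum_nonneg 2 (by norm_num)
    norm_num at hr
    linarith

lemma two_mul_sum_cumSum_mul (h : PositiveMean q x) (g : ℕ → ℝ) :
    2 * ∑ a ∈ range q, cumSum x a * g a =
      ∑ a ∈ range q, cumSum x a * (g a - g (q - 1 - a)) := by
  have h1 : ∑ a ∈ range q, cumSum x a * g a = ∑ a ∈ range q, -(cumSum x a * g (q - 1 - a)) := by
    rw [← sum_range_reflect]
    refine sum_congr rfl fun a ha ↦ ?_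
    rw [h.cumSum_reflect (mem_range.mp ha), neg_mul]
  rw [two_mul]
  nth_rewrite 2 [h1]
  rw [← sum_add_distrib]
  exact sum_congr rfl fun a _ ↦ by ring

lemma cumSum_mul_sub_nonneg (h : PositiveMean q x) {g : ℕ → ℝ}
    (hg : ∀ a b, 1 ≤ a → a < b → b < q → g b ≤ g a) {a : ℕ} (ha : a < q) :
    0 ≤ cumSum x a * (g a - g (q - 1 - a)) := by
  rcases Nat.eq_zero_or_pos a with rfl | ha0
  · simp [cumSum_zero, h.map_zero]
  rcases lt_trichotomy a (q - 1 - a) with hlt | heq | hgt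
  · exact mul_nonneg (h.cumSum_nonneg a (by omega)) (sub_nonneg.2 (hg _ _ ha0 hlt (by omega)))
  · rw [← heq, sub_self, mul_zero]
  · have h1 := h.cumSum_reflect ha
    have h2 := h.cumSum_nonneg (q - 1 - a) (by omega)
    rcases Nat.eq_zero_or_pos (q - 1 - a) with h0 | h0
    · rw [h0, cumSum_zero, h.map_zero] at h1
      rw [show cumSum x a = 0 by linarith, zero_mul]
    · exact mul_nonneg_of_nonpos_of_nonpos (by linarith)
        (sub_nonpos.2 (hg _ _ h0 hgt ha))

lemma sum_cumSum_mul_nonneg (h : PositiveMean q x) {g : ℕ → ℝ}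
    (hg : ∀ a b, 1 ≤ a → a < b → b < q → g b ≤ g a) :
    0 ≤ ∑ a ∈ range q, cumSum x a * g a := by
  have := h.two_mul_sum_cumSum_mul g
  have := sum_nonneg fun a ha ↦ h.cumSum_mul_sub_nonneg hg (mem_range.mp ha)
  linarith

lemma sum_cumSum_mul_pos (h : PositiveMean q x) (h1 : x 1 = 1) {g : ℕ → ℝ}
    (hg : ∀ a b, 1 ≤ a → a < b → b < q → g b ≤ g a) (hlt : g (q - 2) < g 1) :
    0 < ∑ a ∈ range q, cumSum x a * g a := by
  have := h.two_mul_sum_cumSum_mul g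
  have hc : cumSum x 1 = 1 := by rw [cumSum_succ, cumSum_zero, h.map_zero, h1, zero_add]
  have : 0 < ∑ a ∈ range q, cumSum x a * (g a - g (q - 1 - a)) :=
    sum_pos' (fun a ha ↦ h.cumSum_mul_sub_nonneg hg (mem_range.mp ha))
      ⟨1, mem_range.2 h.one_lt, by
        rw [hc, one_mul, sub_pos, show q - 1 - 1 = q - 2 by omega]; exact hlt⟩
  linarith

/-- Pairing with a unimodal even function on the cycle of length `q` is nonnegative. -/
lemma sum_mul_nonneg (h : PositiveMean q x) {f : ℕ → ℝ} (hsym : ∀ a ≤ q, f (q - a) = f a)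
    (hf : ∀ a, 2 * (a + 1) ≤ q → f (a + 1) ≤ f a) :
    0 ≤ ∑ a ∈ range q, x a * f a := by
  have hq := h.one_lt
  have hlast : cumSum x q - x q = 0 := by
    have := cumSum_succ x (q - 1)
    rw [show q - 1 + 1 = q by omega, h.cumSum_last] at this
    linarith
  rw [sum_mul_eq_sum_cumSum_mul, hlast, zero_mul, add_zero]
  refine sum_nonneg fun a ha ↦ ?_
  rw [mem_range] at ha
  have hr := h.cumSum_reflect ha
  rcases lt_trichotomy a (q - 1 - a) with hlt | heq | hgt
  · exact mul_nonneg (h.cumSum_nonneg a (by omega)) (sub_nonneg.2 (hf a (by omega)))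
  · rw [← heq] at hr
    rw [show cumSum x a = 0 by linarith, zero_mul]
  · have h2 := h.cumSum_nonneg (q - 1 - a) (by omega)
    have h3 := hf (q - 1 - a) (by omega)
    rw [show q - 1 - a + 1 = q - a by omega, hsym a ha.le,
      show q - 1 - a = q - (a + 1) by omega, hsym (a + 1) ha] at h3
    exact mul_nonneg_of_nonpos_of_nonpos (by linarith) (by linarith)

end PositiveMean

/-- Up to normalization, the distribution of the lazy random walk on `ℤ/Nℤ` after `m` steps. -/
noncomputable def lazyWalk (N m : ℕ) (k : ℤ) : ℝ :=
  ∑ j ∈ range N, (1 + Real.cos (2 * Real.pi * j / N)) ^ m * Real.cos (2 * Real.pi * j * k / N)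

lemma lazyWalk_neg (N m : ℕ) (k : ℤ) : lazyWalk N m (-k) = lazyWalk N m k := by
  refine sum_congr rfl fun j _ ↦ ?_
  rw [← Real.cos_neg (2 * Real.pi * j * k / N)]
  push_cast
  ring_nf

lemma lazyWalk_sub {N : ℕ} (hN : N ≠ 0) (m : ℕ) (k : ℤ) :
    lazyWalk N m (N - k) = lazyWalk N m k := by
  refine sum_congr rfl fun j _ ↦ ?_
  rw [show 2 * Real.pi * j * ((N - k : ℤ) : ℝ) / N
      = (j : ℤ) * (2 * Real.pi) - 2 * Real.pi * j * k / N by push_cast; field_simp,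
    Real.cos_int_mul_two_pi_sub]

lemma lazyWalk_succ (N m : ℕ) (k : ℤ) :
    lazyWalk N (m + 1) k =
      lazyWalk N m k + (lazyWalk N m (k + 1) + lazyWalk N m (k - 1)) / 2 := by
  simp only [lazyWalk]
  rw [← sum_add_distrib, sum_div, ← sum_add_distrib]
  refine sum_congr rfl fun j _ ↦ ?_
  have e1 : 2 * Real.pi * j * ((k + 1 : ℤ) : ℝ) / N
      = 2 * Real.pi * j * k / N + 2 * Real.pi * j / N := by push_cast; ring
  have e2 : 2 * Real.pi * j * ((k - 1 : ℤ) : ℝ) / N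
      = 2 * Real.pi * j * k / N - 2 * Real.pi * j / N := by push_cast; ring
  rw [e1, e2, Real.cos_add, Real.cos_sub]
  ring

lemma sum_cos_eq_zero {N : ℕ} {k : ℤ} (hk : 0 < k) (hkN : k < N) :
    ∑ j ∈ range N, Real.cos (2 * Real.pi * j * k / N) = 0 := by
  have hN : N ≠ 0 := by rintro rfl; simp at hkN; omega
  have hprim := Complex.isPrimitiveRoot_exp N hN
  lift k to ℕ using hk.le
  have hne : Complex.exp (2 * Real.pi * Complex.I / N) ^ k ≠ 1 :=
    hprim.pow_ne_one_of_pos_of_lt (by omega) (by omega)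
  have hgeom := mul_neg_geom_sum (Complex.exp (2 * Real.pi * Complex.I / N) ^ k) N
  rw [← pow_mul, mul_comm k N, pow_mul, hprim.pow_eq_one, one_pow, sub_self] at hgeom
  have h0 := (mul_eq_zero.1 hgeom).resolve_left (sub_ne_zero.2 hne.symm)
  have := congrArg Complex.re h0
  rw [Complex.re_sum, Complex.zero_re] at this
  rw [← this]
  refine sum_congr rfl fun j _ ↦ ?_
  rw [← pow_mul, ← Complex.exp_nat_mul, ← Complex.exp_ofReal_mul_I_re]
  congr 2
  push_cast
  ring

lemma lazyWalk_antitone {N : ℕ} (hN : N ≠ 0) (m k : ℕ) (hk : 2 * (k + 1) ≤ N) :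
    lazyWalk N m (k + 1) ≤ lazyWalk N m k := by
  induction m generalizing k with
  | zero =>
    rcases Nat.eq_zero_or_pos k with rfl | hk0
    · simp only [lazyWalk]
      gcongr with j
      simpa using Real.cos_le_one _
    · simp only [lazyWalk, pow_zero, one_mul]
      rw [sum_cos_eq_zero (by omega) (by omega), sum_cos_eq_zero (by omega) (by omega)]
  | succ m ih =>
    rw [lazyWalk_succ, lazyWalk_succ, add_sub_cancel_right]
    have h0 := ih k hk
    have hleft : lazyWalk N m k - lazyWalk N m (k + 1) + lazyWalk N m (k - 1)
        - lazyWalk N m k ≥ 0 := by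
      rcases k with _ | k
      · have := lazyWalk_neg N m 1
        simp [this]
      · have := ih k (by omega)
        push_cast at *
        rw [add_sub_cancel_right]
        linarith
    have hright : lazyWalk N m k - lazyWalk N m (k + 1) + lazyWalk N m (k + 1)
        - lazyWalk N m (k + 1 + 1) ≥ 0 := by
      rcases Nat.lt_or_ge N (2 * (k + 2)) with hlt | hge
      · rcases (by omega : N = 2 * k + 2 ∨ N = 2 * k + 3) with hN' | hN'
        · have := lazyWalk_sub hN m k
          rw [show (N : ℤ) - k = k + 1 + 1 by omega] at this
          linarith
        · have := lazyWalk_sub hN m (k + 1)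
          rw [show (N : ℤ) - (k + 1) = k + 1 + 1 by omega] at this
          linarith
      · have := ih (k + 1) (by omega)
        push_cast at this
        linarith
    linarith

lemma lazyWalk_le {N : ℕ} (hN : N ≠ 0) (m : ℕ) {k l : ℕ} (hkl : k ≤ l) (hl : 2 * l ≤ N) :
    lazyWalk N m l ≤ lazyWalk N m k := by
  induction l, hkl using Nat.le_induction with
  | base => rfl
  | succ l hkl ih =>
    refine le_trans ?_ (ih (by omega))
    exact_mod_cast lazyWalk_antitone hN m l hl

namespace PositiveMean

variable {q : ℕ} {x : ℕ → ℝ}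

lemma sum_mul_lazyWalk_nonneg (h : PositiveMean q x) {n : ℕ} (hn : 1 ≤ n) (m : ℕ) :
    0 ≤ ∑ a ∈ range q, x a * lazyWalk (q * n) m ((n * a : ℕ) : ℤ) := by
  have hN : q * n ≠ 0 := by have := h.one_lt; positivity
  refine h.sum_mul_nonneg (fun a ha ↦ ?_) (fun a ha ↦ ?_)
  · rw [← lazyWalk_sub hN m ((n * a : ℕ) : ℤ)]
    congr 1
    push_cast [Nat.cast_sub ha]
    ring
  · exact lazyWalk_le hN m (by gcongr; omega) (by nlinarith)

/-- If `x` is an eigenfunction of the cosine transform for the positive eigenvalue `τ`, then `x` is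
heat positive. -/
lemma heat_nonneg (h : PositiveMean q x) {τ : ℝ} (hτ : 0 < τ)
    (hcos : ∀ j : ℕ, ∑ a ∈ range q, x a * Real.cos (2 * Real.pi * a * j / q) = τ * x j)
    {n : ℕ} (hn : 1 ≤ n) {t : ℝ} (ht : 0 ≤ t) :
    0 ≤ ∑ j ∈ range (q * n),
      x j * Real.exp (-(4 * t * Real.sin (Real.pi * j / (q * n)) ^ 2)) := by
  have hq := h.one_lt
  have hmom (m : ℕ) :
      0 ≤ ∑ j ∈ range (q * n), x j * (1 + Real.cos (2 * Real.pi * j / (q * n))) ^ m := by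
    refine nonneg_of_mul_nonneg_right (a := τ) ?_ hτ
    refine (h.sum_mul_lazyWalk_nonneg hn m).trans_eq ?_
    simp only [lazyWalk, mul_sum]
    rw [sum_comm]
    refine sum_congr rfl fun j _ ↦ ?_
    rw [← mul_assoc, ← hcos, sum_mul]
    refine sum_congr rfl fun a _ ↦ ?_
    rw [show 2 * Real.pi * j * (((n * a : ℕ) : ℤ) : ℝ) / ((q * n : ℕ) : ℝ)
      = 2 * Real.pi * a * j / q by push_cast; field_simp]
    push_cast
    ring
  have hexp (j : ℕ) : Real.exp (-(4 * t * Real.sin (Real.pi * j / (q * n)) ^ 2)) =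
      Real.exp (-(4 * t)) * Real.exp (2 * t * (1 + Real.cos (2 * Real.pi * j / (q * n)))) := by
    rw [← Real.exp_add, show 2 * Real.pi * j / (q * n) = 2 * (Real.pi * j / (q * n)) by ring,
      Real.cos_two_mul, Real.cos_sq']
    congr 1
    ring
  have hsum : HasSum (fun m : ℕ ↦ (2 * t) ^ m / m.factorial *
      ∑ j ∈ range (q * n), x j * (1 + Real.cos (2 * Real.pi * j / (q * n))) ^ m)
      (∑ j ∈ range (q * n),
        x j * Real.exp (2 * t * (1 + Real.cos (2 * Real.pi * j / (q * n))))) := by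
    simp only [mul_sum, Real.exp_eq_exp_ℝ]
    refine hasSum_sum fun j _ ↦ ?_
    convert! (NormedSpace.expSeries_div_hasSum_exp
      (2 * t * (1 + Real.cos (2 * Real.pi * j / (q * n))))).mul_left (x j) using 2 with m
    rw [mul_pow (2 * t)]
    ring
  have := hsum.nonneg fun m ↦ mul_nonneg (by positivity) (hmom m)
  simp only [hexp, mul_left_comm (x _) (Real.exp (-(4 * t))), ← mul_sum]
  positivity

end PositiveMean

namespace PositiveMean

variable {q : ℕ} {x : ℕ → ℝ}

lemma exists_abs_cumSum_le (h : PositiveMean q x) : ∃ C, ∀ m, |cumSum x m| ≤ C := by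
  refine ⟨∑ a ∈ range q, |cumSum x a|, fun m ↦ ?_⟩
  rw [← (show Function.Periodic (cumSum x) q from h.cumSum_add_period).map_mod_nat]
  exact single_le_sum (f := fun a ↦ |cumSum x a|) (fun _ _ ↦ abs_nonneg _)
    (mem_range.2 (Nat.mod_lt _ (by have := h.one_lt; omega)))

lemma sum_shift_cumSum_mul_nonneg (h : PositiveMean q x) {g : ℕ → ℝ}
    (hg : ∀ a b, 1 ≤ a → a < b → g b ≤ g a) (k : ℕ) :
    0 ≤ ∑ a ∈ range q, cumSum x (k * q + a) * g (k * q + a) := by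
  have hper (a : ℕ) : cumSum x (k * q + a) = cumSum x a := by
    rw [add_comm, ← (show Function.Periodic (cumSum x) q from h.cumSum_add_period).nat_mul k a]
    simp
  simp only [hper]
  exact h.sum_cumSum_mul_nonneg fun a b ha hab _ ↦ hg _ _ (by omega) (by omega)

lemma sum_cumSum_mul_le_sum (h : PositiveMean q x) {g : ℕ → ℝ}
    (hg : ∀ a b, 1 ≤ a → a < b → g b ≤ g a) (K : ℕ) :
    ∑ a ∈ range q, cumSum x a * g a ≤ ∑ a ∈ range ((K + 1) * q), cumSum x a * g a := by
  induction K with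
  | zero => simp
  | succ K ih =>
    rw [show (K + 1 + 1) * q = (K + 1) * q + q by ring, sum_range_add]
    have := h.sum_shift_cumSum_mul_nonneg hg (K + 1)
    linarith

end PositiveMean

open MeasureTheory Filter Topology

lemma measurable_comp_floor (c : ℕ → ℝ) : Measurable fun t : ℝ ↦ c ⌊t⌋₊ :=
  (measurable_of_countable c).comp Nat.measurable_floor

lemma integrableOn_comp_floor_mul_rpow {c : ℕ → ℝ} {C : ℝ} (hc : ∀ m, |c m| ≤ C) {s : ℝ}
    (hs : 0 < s) : IntegrableOn (fun t : ℝ ↦ c ⌊t⌋₊ * t ^ (-(s + 1))) (Set.Ioi 1) :=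
  (integrableOn_Ioi_rpow_of_lt (by linarith) one_pos).bdd_mul
    (measurable_comp_floor c).aestronglyMeasurable (.of_forall fun _ ↦ hc _)

lemma integral_comp_floor_mul {c : ℕ → ℝ} (f : ℝ → ℝ) (n : ℕ) :
    ∫ t in (n : ℝ)..(n + 1 : ℕ), c ⌊t⌋₊ * f t = c n * ∫ t in (n : ℝ)..(n + 1 : ℕ), f t := by
  rw [← intervalIntegral.integral_const_mul]
  refine intervalIntegral.integral_congr_Ioo_of_le (by simp) fun t ht ↦ ?_
  have : ⌊t⌋₊ = n := by
    rw [Nat.floor_eq_iff (by linarith [ht.1, n.cast_nonneg (α := ℝ)])]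
    exact ⟨ht.1.le, by simpa using ht.2⟩
  simp [this]

lemma intervalIntegrable_rpow_neg (s : ℝ) {n : ℕ} (hn : 1 ≤ n) :
    IntervalIntegrable (fun t : ℝ ↦ t ^ (-(s + 1))) volume n (n + 1 : ℕ) := by
  refine intervalIntegral.intervalIntegrable_rpow (.inr ?_)
  rw [Set.uIcc_of_le (by simp)]
  simp only [Set.mem_Icc, not_and_or, not_le]
  left
  exact_mod_cast hn

lemma integral_rpow_neg_le {s : ℝ} (hs : 0 < s) {n : ℕ} (hn : 1 ≤ n) :
    ∫ t in (n : ℝ)..(n + 1 : ℕ), t ^ (-(s + 1)) ≤ (n : ℝ) ^ (-(s + 1)) := by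
  have hn0 : (0 : ℝ) < n := by exact_mod_cast hn
  have := intervalIntegral.integral_mono_on (by simp) (intervalIntegrable_rpow_neg s hn)
    (intervalIntegrable_const (c := (n : ℝ) ^ (-(s + 1))))
    fun t ht ↦ Real.rpow_le_rpow_of_nonpos hn0 ht.1 (by linarith)
  simpa using this

lemma le_integral_rpow_neg {s : ℝ} (hs : 0 < s) {n : ℕ} (hn : 1 ≤ n) :
    ((n + 1 : ℕ) : ℝ) ^ (-(s + 1)) ≤ ∫ t in (n : ℝ)..(n + 1 : ℕ), t ^ (-(s + 1)) := by
  have hn0 : (0 : ℝ) < n := by exact_mod_cast hn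
  have := intervalIntegral.integral_mono_on (by simp)
    (intervalIntegrable_const (c := ((n + 1 : ℕ) : ℝ) ^ (-(s + 1))))
    (intervalIntegrable_rpow_neg s hn)
    fun t ht ↦ Real.rpow_le_rpow_of_nonpos (hn0.trans_le ht.1) ht.2 (by linarith)
  simpa using this

/-- The Dirichlet series of `x`, written as an integral over its cumulative sums, is positive. -/
lemma PositiveMean.integral_pos {q : ℕ} {x : ℕ → ℝ} (h : PositiveMean q x) (h1 : x 1 = 1) {s : ℝ}
    (hs : 0 < s) : 0 < ∫ t in Set.Ioi (1 : ℝ), cumSum x ⌊t⌋₊ * t ^ (-(s + 1)) := by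
  obtain ⟨C, hC⟩ := h.exists_abs_cumSum_le
  have hq := h.five_le h1
  set G : ℕ → ℝ := fun n ↦ ∫ t in (n : ℝ)..(n + 1 : ℕ), t ^ (-(s + 1))
  have hanti (a b : ℕ) (ha : 1 ≤ a) (hab : a < b) : G b ≤ G a :=
    calc G b ≤ (b : ℝ) ^ (-(s + 1)) := integral_rpow_neg_le hs (by omega)
      _ ≤ ((a + 1 : ℕ) : ℝ) ^ (-(s + 1)) :=
        Real.rpow_le_rpow_of_nonpos (by positivity) (by exact_mod_cast hab) (by linarith)
      _ ≤ G a := le_integral_rpow_neg hs ha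
  have hlt : G (q - 2) < G 1 :=
    calc G (q - 2) ≤ ((q - 2 : ℕ) : ℝ) ^ (-(s + 1)) := integral_rpow_neg_le hs (by omega)
      _ < ((1 + 1 : ℕ) : ℝ) ^ (-(s + 1)) :=
        Real.rpow_lt_rpow_of_neg (by positivity)
          (by exact_mod_cast (by omega : 1 + 1 < q - 2)) (by linarith)
      _ ≤ G 1 := le_integral_rpow_neg hs le_rfl
  have hpos := h.sum_cumSum_mul_pos h1 (fun a b ha hab _ ↦ hanti a b ha hab) hlt
  have hint := integrableOn_comp_floor_mul_rpow hC hs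
  have hpartial (M : ℕ) (hM : 1 ≤ M) :
      ∫ t in (1 : ℝ)..M, cumSum x ⌊t⌋₊ * t ^ (-(s + 1)) =
        ∑ n ∈ range M, cumSum x n * G n := by
    induction M, hM using Nat.le_induction with
    | base => simp [cumSum_zero, h.map_zero]
    | succ M hM ih =>
      have hM' : (1 : ℝ) ≤ M := by exact_mod_cast hM
      have hM'' : (M : ℝ) ≤ (M + 1 : ℕ) := by simp
      rw [sum_range_succ, ← ih, ← intervalIntegral.integral_add_adjacent_intervals (b := (M : ℝ)),
        integral_comp_floor_mul]
      · rw [intervalIntegrable_iff_integrableOn_Ioc_of_le hM']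
        exact hint.mono_set Set.Ioc_subset_Ioi_self
      · rw [intervalIntegrable_iff_integrableOn_Ioc_of_le hM'']
        exact hint.mono_set fun t ht ↦ hM'.trans_lt ht.1
  have hb : Tendsto (fun K : ℕ ↦ (((K + 1) * q : ℕ) : ℝ)) atTop atTop :=
    tendsto_natCast_atTop_atTop.comp
      (tendsto_atTop_mono (fun K ↦ show K ≤ (K + 1) * q by nlinarith) tendsto_id)
  have hlim := intervalIntegral_tendsto_integral_Ioi 1 hint hb
  refine hpos.trans_le (ge_of_tendsto' hlim fun K ↦ ?_)
  rw [hpartial _ (by nlinarith)]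
  exact h.sum_cumSum_mul_le_sum hanti K

/-- The integral over a bounded step function obtained by summation by parts is holomorphic in the
right half-plane. -/
lemma differentiableOn_integral_comp_floor_mul_cpow {c : ℕ → ℝ} {C : ℝ} (hc : ∀ m, |c m| ≤ C) :
    DifferentiableOn ℂ
      (fun s : ℂ ↦ s * ∫ t in Set.Ioi (1 : ℝ), (c ⌊t⌋₊ : ℂ) * (t : ℂ) ^ (-(s + 1)))
      {s | 0 < s.re} := by
  set f : ℝ → ℂ := (Set.Ioi 1).indicator fun t : ℝ ↦ (c ⌊t⌋₊ : ℂ)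
  have hfm : Measurable f :=
    (Complex.measurable_ofReal.comp (measurable_comp_floor c)).indicator measurableSet_Ioi
  have hfb (t : ℝ) : ‖f t‖ ≤ C := by
    refine (norm_indicator_le_norm_self _ _).trans ?_
    simpa using hc ⌊t⌋₊
  have hmellin (s : ℂ) : ∫ t in Set.Ioi (1 : ℝ), (c ⌊t⌋₊ : ℂ) * (t : ℂ) ^ (-(s + 1)) =
      mellin f (-s) := by
    rw [mellin, ← integral_indicator measurableSet_Ioi, ← integral_indicator measurableSet_Ioi]
    congr 1 with t
    by_cases ht : 1 < t
    · have : 0 < t := by linarith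
      simp only [Set.indicator, Set.mem_Ioi, ht, this, if_true, f, smul_eq_mul]
      rw [mul_comm]
      ring_nf
    · simp [Set.indicator, f, ht]
  intro s hs
  refine (differentiableAt_id.mul ?_).differentiableWithinAt
  simp only [hmellin]
  refine DifferentiableAt.comp s (f := fun s : ℂ ↦ -s) (g := mellin f) ?_ (by fun_prop)
  refine mellin_differentiableAt_of_isBigO_rpow (a := 0) (b := -s.re - 1) ?_ ?_ ?_ ?_ ?_
  · refine LocallyIntegrable.locallyIntegrableOn ?_ _
    exact (locallyIntegrable_const C).mono hfm.aestronglyMeasurable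
      (.of_forall fun t ↦ (hfb t).trans (le_abs_self C))
  · simp only [neg_zero, Real.rpow_zero]
    exact Asymptotics.IsBigO.of_bound C (.of_forall fun t ↦ by simpa using hfb t)
  · simpa using hs
  · refine Asymptotics.IsBigO.of_bound 0 ?_
    filter_upwards [nhdsWithin_le_nhds (Iio_mem_nhds one_pos)] with t ht
    have : t ∉ Set.Ioi (1 : ℝ) := fun h ↦ lt_asymm (Set.mem_Iio.1 ht) (Set.mem_Ioi.1 h)
    simp [f, this]
  · simp

lemma ZMod.sum_eq_sum_range {M : Type*} [AddCommMonoid M] {q : ℕ} [NeZero q] (f : ZMod q → M) :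
    ∑ j, f j = ∑ a ∈ range q, f a := by
  refine sum_nbij' ZMod.val (fun a ↦ (a : ZMod q)) (fun j _ ↦ mem_range.2 j.val_lt)
    (fun _ _ ↦ mem_univ _) (fun j _ ↦ j.natCast_zmod_val)
    (fun a ha ↦ ZMod.val_cast_of_lt (mem_range.1 ha)) fun j _ ↦ by rw [j.natCast_zmod_val]

lemma sum_Ico_one_eq_sum_range {M : Type*} [AddCommMonoid M] {f : ℕ → M} (h0 : f 0 = 0) (n : ℕ) :
    ∑ j ∈ Ico 1 n, f j = ∑ j ∈ range n, f j := by
  refine sum_subset (fun j hj ↦ ?_) fun j hj hj' ↦ ?_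
  · simp only [mem_Ico, mem_range] at *; omega
  · simp only [mem_Ico, mem_range] at *
    rw [show j = 0 by omega, h0]

namespace DirichletCharacter

variable {q : ℕ} {χ : DirichletCharacter ℂ q}

lemma inv_eq_self_of_im_eq_zero (hreal : ∀ x : ZMod q, (χ x).im = 0) : χ⁻¹ = χ := by
  rw [← MulChar.star_eq_inv]
  ext a
  exact Complex.conj_eq_iff_im.2 (hreal a)

lemma apply_zero_of_one_lt (hq : 1 < q) (χ : DirichletCharacter ℂ q) : χ 0 = 0 := by
  have : Fact (1 < q) := ⟨hq⟩
  exact χ.map_nonunit not_isUnit_zero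

variable [NeZero q]

lemma IsPrimitive.ne_one (hprim : χ.IsPrimitive) (hq : 1 < q) : χ ≠ 1 := by
  rintro rfl
  rw [isPrimitive_def, conductor_one] at hprim
  omega

lemma positiveMean (hq : 1 < q) (hprim : χ.IsPrimitive) (hχ : χ.Even)
    (hmean : ∀ m : ℕ, 2 * m ≤ q → 0 ≤ ∑ j ∈ range (m + 1), (χ (j : ZMod q)).re) :
    PositiveMean q fun j ↦ (χ (j : ZMod q)).re where
  one_lt := hq
  map_zero := by simp [apply_zero_of_one_lt hq χ]
  periodic a := by simp
  map_sub a ha := by simp [Nat.cast_sub ha, hχ.eval_neg]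
  cumSum_last := by
    have := congrArg Complex.re (MulChar.sum_eq_zero_of_ne_one (hprim.ne_one hq))
    rw [ZMod.sum_eq_sum_range, Complex.re_sum] at this
    rwa [cumSum, Nat.sub_add_cancel hq.le]
  cumSum_nonneg := hmean

lemma fourierTransform_eq_mul_gaussSum (hprim : χ.IsPrimitive) (hχ : χ.Even)
    (hreal : ∀ x : ZMod q, (χ x).im = 0) (k : ZMod q) :
    ZMod.dft χ k = χ k * gaussSum χ ZMod.stdAddChar := by
  rw [hprim.fourierTransform_eq_inv_mul_gaussSum, inv_eq_self_of_im_eq_zero hreal, hχ.eval_neg]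

lemma gaussSum_mul_self (hprim : χ.IsPrimitive) (hχ : χ.Even)
    (hreal : ∀ x : ZMod q, (χ x).im = 0) :
    gaussSum χ ZMod.stdAddChar * gaussSum χ ZMod.stdAddChar = q := by
  have h := congrFun (ZMod.dft_dft (χ : ZMod q → ℂ)) 1
  rw [funext (fourierTransform_eq_mul_gaussSum hprim hχ hreal), ZMod.dft_mul_const] at h
  simpa [fourierTransform_eq_mul_gaussSum hprim hχ hreal, hχ.eval_neg] using h

lemma gaussSum_im_eq_zero (hprim : χ.IsPrimitive) (hχ : χ.Even)
    (hreal : ∀ x : ZMod q, (χ x).im = 0) : (gaussSum χ ZMod.stdAddChar).im = 0 := by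
  have h := gaussSum_mul_self hprim hχ hreal
  have hre := congrArg Complex.re h
  have him := congrArg Complex.im h
  simp only [Complex.mul_re, Complex.mul_im, Complex.natCast_re, Complex.natCast_im] at hre him
  have hq : (0 : ℝ) < q := by exact_mod_cast NeZero.pos q
  by_contra hne
  have : (gaussSum χ ZMod.stdAddChar).re = 0 := by
    refine (mul_eq_zero.1 (?_ : _ * (gaussSum χ ZMod.stdAddChar).im = 0)).resolve_right hne
    linarith
  rw [this] at hre
  nlinarith

lemma sum_re_mul_cos (hprim : χ.IsPrimitive) (hχ : χ.Even)
    (hreal : ∀ x : ZMod q, (χ x).im = 0) (j : ℕ) :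
    ∑ a ∈ range q, (χ (a : ZMod q)).re * Real.cos (2 * Real.pi * a * j / q) =
      (gaussSum χ ZMod.stdAddChar).re * (χ (j : ZMod q)).re := by
  have h := congrArg Complex.re (fourierTransform_eq_mul_gaussSum hprim hχ hreal j)
  rw [Complex.mul_re, hreal, zero_mul, sub_zero, ZMod.dft_apply, ZMod.sum_eq_sum_range,
    Complex.re_sum] at h
  refine Eq.trans ?_ (h.trans (mul_comm _ _))
  refine sum_congr rfl fun a _ ↦ ?_
  rw [smul_eq_mul, Complex.mul_re, hreal, mul_zero, sub_zero, mul_comm]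
  congr 1
  rw [show -((a : ZMod q) * (j : ZMod q)) = ((-(a * j) : ℤ) : ZMod q) by push_cast; ring,
    ZMod.stdAddChar_coe, ← Real.cos_neg, ← Complex.exp_ofReal_mul_I_re]
  congr 2
  push_cast
  ring

lemma gaussSum_eq_sqrt (hprim : χ.IsPrimitive) (hχ : χ.Even)
    (hreal : ∀ x : ZMod q, (χ x).im = 0)
    (hpm : PositiveMean q fun j ↦ (χ (j : ZMod q)).re) :
    gaussSum χ ZMod.stdAddChar = (Real.sqrt q : ℂ) := by
  have him := gaussSum_im_eq_zero hprim hχ hreal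
  have hsq := congrArg Complex.re (gaussSum_mul_self hprim hχ hreal)
  rw [Complex.mul_re, him, mul_zero, sub_zero, Complex.natCast_re] at hsq
  have hcos := sum_re_mul_cos hprim hχ hreal 1
  have hq : (0 : ℝ) < q := by exact_mod_cast NeZero.pos q
  have hnonneg : 0 ≤ (gaussSum χ ZMod.stdAddChar).re := by
    simp only [Nat.cast_one, map_one, Complex.one_re, mul_one] at hcos
    rw [← hcos]
    refine hpm.sum_mul_nonneg (fun a ha ↦ ?_) (fun a ha ↦ ?_)
    · rw [← Real.cos_two_pi_sub]
      congr 1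
      push_cast [Nat.cast_sub ha]
      field_simp
      ring
    · have ha' : 2 * ((a : ℝ) + 1) ≤ q := by exact_mod_cast ha
      refine Real.cos_le_cos_of_nonneg_of_le_pi (by positivity) ?_ ?_
      · rw [div_le_iff₀ hq]
        push_cast
        nlinarith [Real.pi_pos]
      · gcongr
        simp
  refine Complex.ext ?_ (by simpa using him)
  rw [Complex.ofReal_re, ← hsq, Real.sqrt_mul_self hnonneg]

lemma LFunction_eq_mul_integral (hq : 1 < q) (hprim : χ.IsPrimitive)
    (hreal : ∀ x : ZMod q, (χ x).im = 0)
    (hpm : PositiveMean q fun j ↦ (χ (j : ZMod q)).re) {s : ℂ} (hs : 0 < s.re) :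
    LFunction χ s = s * ∫ t in Set.Ioi (1 : ℝ),
      (cumSum (fun j ↦ (χ (j : ZMod q)).re) ⌊t⌋₊ : ℂ) * (t : ℂ) ^ (-(s + 1)) := by
  obtain ⟨C, hC⟩ := hpm.exists_abs_cumSum_le
  have hsum (n : ℕ) : ∑ k ∈ Icc 1 n, χ (k : ZMod q) =
      (cumSum (fun j ↦ (χ (j : ZMod q)).re) n : ℂ) := by
    rw [← Ico_add_one_right_eq_Icc,
      sum_Ico_one_eq_sum_range (by simp [apply_zero_of_one_lt hq χ]), cumSum, Complex.ofReal_sum]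
    exact sum_congr rfl fun k _ ↦ Complex.ext (by simp) (by simp [hreal])
  have hopen : IsOpen {s : ℂ | 0 < s.re} := isOpen_lt continuous_const Complex.continuous_re
  refine ((differentiable_LFunction (hprim.ne_one hq)).differentiableOn.analyticOnNhd
    hopen).eqOn_of_preconnected_of_eventuallyEq
    ((differentiableOn_integral_comp_floor_mul_cpow hC).analyticOnNhd hopen)
    (convex_halfSpace_re_gt 0).isPreconnected (by simp : (2 : ℂ) ∈ _) ?_ hs
  filter_upwards [(isOpen_lt continuous_const Complex.continuous_re).mem_nhds
    (by norm_num : (1 : ℝ) < (2 : ℂ).re)] with z hz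
  rw [LFunction_eq_LSeries χ hz, LSeries_eq_mul_integral _ le_rfl (zero_lt_one.trans hz)
    (ZMod.LSeriesSummable_of_one_lt_re χ hz)]
  · simp only [hsum]
  · simp only [hsum, Real.rpow_zero]
    exact Asymptotics.IsBigO.of_bound C (.of_forall fun n ↦ by simpa using hC n)

end DirichletCharacter

theorem positive_mean_implies_heat_positive_and_no_real_zeros
    {q : ℕ} [NeZero q] (hq : 1 < q)
    (χ : DirichletCharacter ℂ q) (hprim : χ.IsPrimitive) (hχ : χ (-1) = 1)
    (hreal : ∀ x : ZMod q, (χ x).im = 0)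
    (hmean : ∀ m : ℕ, 2 * m ≤ q →
      ∃ r : ℝ, 0 ≤ r ∧ ∑ j ∈ Finset.range (m + 1), χ (j : ZMod q) = (r : ℂ)) :
    (∀ n : ℕ, 1 ≤ n → ∀ t : ℝ, 0 ≤ t →
      ∃ r : ℝ, 0 ≤ r ∧
        ∑ j ∈ Finset.Ico 1 (q * n),
          χ (j : ZMod q) *
            (Real.exp (-(4 * t * Real.sin (Real.pi * j / (q * n)) ^ 2)) : ℂ) = (r : ℂ)) ∧
    (∑ j ∈ Finset.Icc 1 q,
        χ (j : ZMod q) * Complex.exp (2 * Real.pi * Complex.I * j / q) =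
      (Real.sqrt q : ℂ)) ∧
    (∀ s : ℝ, 0 < s → s < 1 →
      ∃ r : ℝ, 0 < r ∧ DirichletCharacter.LFunction χ (s : ℂ) = (r : ℂ)) := by
  have hpm : PositiveMean q fun j ↦ (χ (j : ZMod q)).re := by
    refine DirichletCharacter.positiveMean hq hprim hχ fun m hm ↦ ?_
    obtain ⟨r, hr, hsum⟩ := hmean m hm
    rw [← Complex.re_sum, hsum]
    exact hr
  have hχ0 := DirichletCharacter.apply_zero_of_one_lt hq χ
  have hofReal (a : ZMod q) : χ a = ((χ a).re : ℂ) := Complex.ext (by simp) (by simp [hreal])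
  have hgauss := DirichletCharacter.gaussSum_eq_sqrt hprim hχ hreal hpm
  refine ⟨fun n hn t ht ↦ ⟨_, hpm.heat_nonneg (τ := Real.sqrt q) ?_ (fun j ↦ ?_) hn ht, ?_⟩, ?_,
    fun s hs _ ↦ ⟨_, mul_pos hs (hpm.integral_pos (by simp) hs), ?_⟩⟩
  · exact Real.sqrt_pos.2 (by exact_mod_cast NeZero.pos q)
  · have := DirichletCharacter.sum_re_mul_cos hprim hχ hreal j
    rwa [hgauss, Complex.ofReal_re] at this
  · rw [sum_Ico_one_eq_sum_range (by simp [hχ0]), Complex.ofReal_sum]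
    refine sum_congr rfl fun j _ ↦ ?_
    rw [Complex.ofReal_mul, ← hofReal]
  · rw [← hgauss, gaussSum, ZMod.sum_eq_sum_range, ← Ico_add_one_right_eq_Icc,
      sum_Ico_one_eq_sum_range (by simp [hχ0]), sum_range_succ]
    simp only [CharP.cast_eq_zero, hχ0, zero_mul, add_zero]
    refine sum_congr rfl fun j _ ↦ ?_
    have := ZMod.stdAddChar_coe (N := q) j
    push_cast at this
    rw [this]
  · rw [DirichletCharacter.LFunction_eq_mul_integral hq hprim hreal hpm (by simpa using hs),
      Complex.ofReal_mul, ← integral_complex_ofReal]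
    congr 1
    refine setIntegral_congr_fun measurableSet_Ioi fun t ht ↦ ?_
    have ht0 : (0 : ℝ) ≤ t := zero_le_one.trans (le_of_lt ht)
    simp only [Complex.ofReal_mul, Complex.ofReal_cpow ht0]
    push_cast
    rfl
end

section
/- Let q > 1 and let χ be a primitive, real, even Dirichlet character of conductor q (i.e. χ is primitive, χ(-1) = 1, and all values of χ are real). Suppose χ is heat positive: there exists a strictly increasing sequence of positive integers n_1 < n_2 < … such that for every i and every real t ≥ 0, ∑_{j=1}^{q·n_i−1} χ(j)·e^{−4t sin²(πj/(q·n_i))} ≥ 0 (the sum being real since χ is real). Then L(s,χ) is a positive real number for every real s with 0 < s < 1. -/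
open Finset

/-- The one-sided theta series `∑ aₙ exp (-n² t)`. -/
noncomputable def thetaSeries (a : ℕ → ℝ) (t : ℝ) : ℝ :=
  ∑' n : ℕ, a n * Real.exp (-(n : ℝ) ^ 2 * t)

theorem summable_exp_neg_sq_mul {t : ℝ} (ht : 0 < t) :
    Summable fun n : ℕ => Real.exp (-(n : ℝ) ^ 2 * t) := by
  have h := Real.summable_exp_nat_mul_of_ge (neg_lt_zero.mpr ht) (f := fun n : ℕ => (n : ℝ) ^ 2)
    (fun n => by exact_mod_cast Nat.le_self_pow two_ne_zero n)
  refine h.congr fun n => ?_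
  congr 1
  ring

theorem norm_mul_exp_le {x y : ℝ} (hx : |x| ≤ 1) : ‖x * Real.exp y‖ ≤ Real.exp y := by
  rw [Real.norm_eq_abs, abs_mul, Real.abs_exp]
  exact mul_le_of_le_one_left (Real.exp_pos y).le hx

theorem hasSum_thetaSeries {a : ℕ → ℝ} (ha : ∀ n, |a n| ≤ 1) {t : ℝ} (ht : 0 < t) :
    HasSum (fun n : ℕ => a n * Real.exp (-(n : ℝ) ^ 2 * t)) (thetaSeries a t) :=
  ((summable_exp_neg_sq_mul ht).of_norm_bounded fun n => norm_mul_exp_le (ha n)).hasSum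

theorem continuousOn_thetaSeries {a : ℕ → ℝ} (ha : ∀ n, |a n| ≤ 1) :
    ContinuousOn (thetaSeries a) (Set.Ioi 0) := by
  intro t ht
  have ht' : 0 < t := ht
  have h : ContinuousOn (thetaSeries a) (Set.Ioi (t / 2)) := by
    refine continuousOn_tsum (fun n => by fun_prop)
      (summable_exp_neg_sq_mul (half_pos ht')) fun n x hx => ?_
    refine (norm_mul_exp_le (ha n)).trans (Real.exp_le_exp.mpr ?_)
    have hx' : t / 2 < x := hx
    nlinarith [sq_nonneg (n : ℝ)]
  exact (h.continuousAt (Ioi_mem_nhds (half_lt_self ht'))).continuousWithinAt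

open Filter Topology in
theorem tendsto_exp_mul_thetaSeries {a : ℕ → ℝ} (ha : ∀ n, |a n| ≤ 1) (ha0 : a 0 = 0) :
    Tendsto (fun t => Real.exp t * thetaSeries a t) atTop (𝓝 (a 1)) := by
  have h : Tendsto (fun t : ℝ => ∑' n : ℕ, a n * Real.exp (-((n : ℝ) ^ 2 - 1) * t)) atTop
      (𝓝 (∑' n : ℕ, if n = 1 then a 1 else 0)) := by
    refine tendsto_tsum_of_dominated_convergence
      (bound := fun n : ℕ => Real.exp 1 * Real.exp (-(n : ℝ) ^ 2 * 1))
      ((summable_exp_neg_sq_mul one_pos).mul_left _) (fun n => ?_) ?_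
    · rcases lt_trichotomy n 1 with hn | rfl | hn
      · obtain rfl : n = 0 := by omega
        simp [ha0]
      · simp
      · have hn' : (2 : ℝ) ≤ n := by exact_mod_cast hn
        have h1 : Tendsto (fun t : ℝ => -((n : ℝ) ^ 2 - 1) * t) atTop atBot :=
          tendsto_id.const_mul_atTop_of_neg (by nlinarith)
        simpa [hn.ne'] using (Real.tendsto_exp_atBot.comp h1).const_mul (a n)
    · filter_upwards [eventually_ge_atTop 1] with t ht n
      rcases Nat.eq_zero_or_pos n with rfl | hn
      · simp only [ha0, zero_mul, norm_zero]
        positivity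
      · refine (norm_mul_exp_le (ha n)).trans ?_
        rw [← Real.exp_add, Real.exp_le_exp]
        have hn' : (1 : ℝ) ≤ n := by exact_mod_cast hn
        nlinarith [mul_nonneg (by nlinarith : (0 : ℝ) ≤ (n : ℝ) ^ 2 - 1) (sub_nonneg.mpr ht)]
  rw [tsum_ite_eq] at h
  refine h.congr fun t => ?_
  rw [thetaSeries, ← tsum_mul_left]
  refine tsum_congr fun n => ?_
  rw [mul_left_comm, ← Real.exp_add]
  ring_nf

theorem abs_sum_mul_antitone_le {a w : ℕ → ℝ} {C : ℝ} (hw : Antitone w) (hw0 : ∀ n, 0 ≤ w n)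
    (hC : ∀ n, |∑ i ∈ range n, a i| ≤ C) (n : ℕ) :
    |∑ i ∈ range n, a i * w i| ≤ C * w 0 := by
  have h : |∑ i ∈ range n, a i * w i - w n * ∑ i ∈ range n, a i| ≤ C * (w 0 - w n) := by
    induction n with
    | zero => simp
    | succ n ih =>
      have h1 : ∑ i ∈ range (n + 1), a i * w i - w (n + 1) * ∑ i ∈ range (n + 1), a i =
          (∑ i ∈ range n, a i * w i - w n * ∑ i ∈ range n, a i) +
            (w n - w (n + 1)) * ∑ i ∈ range (n + 1), a i := by
        simp only [sum_range_succ]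
        ring
      have h2 : 0 ≤ w n - w (n + 1) := sub_nonneg.mpr (hw n.le_succ)
      calc _ ≤ C * (w 0 - w n) + (w n - w (n + 1)) * C := by
            rw [h1]
            refine (abs_add_le _ _).trans (add_le_add ih ?_)
            rw [abs_mul, abs_of_nonneg h2]
            exact mul_le_mul_of_nonneg_left (hC _) h2
        _ = _ := by ring
  have h2 : |w n * ∑ i ∈ range n, a i| ≤ w n * C := by
    rw [abs_mul, abs_of_nonneg (hw0 n)]
    exact mul_le_mul_of_nonneg_left (hC n) (hw0 n)
  rw [abs_le] at h h2 ⊢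
  constructor <;> linarith [h.1, h.2, h2.1, h2.2]

theorem abs_thetaSeries_le {a : ℕ → ℝ} (ha : ∀ n, |a n| ≤ 1) {C : ℝ}
    (hC : ∀ n, |∑ i ∈ range n, a i| ≤ C) {t : ℝ} (ht : 0 < t) : |thetaSeries a t| ≤ C := by
  refine le_of_tendsto (hasSum_thetaSeries ha ht).tendsto_sum_nat.abs
    (Filter.Eventually.of_forall fun n => ?_)
  have hw : Antitone fun n : ℕ => Real.exp (-(n : ℝ) ^ 2 * t) := by
    intro m n hmn
    have : (m : ℝ) ^ 2 ≤ (n : ℝ) ^ 2 := by gcongr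
    exact Real.exp_le_exp.mpr (by nlinarith)
  simpa using abs_sum_mul_antitone_le hw (fun n => (Real.exp_pos _).le) hC n

theorem abs_sum_range_le_of_periodic {a : ℕ → ℝ} (ha : ∀ n, |a n| ≤ 1) {q : ℕ} (hq : 0 < q)
    (hper : Function.Periodic a q) (hsum : ∑ i ∈ range q, a i = 0) (n : ℕ) :
    |∑ i ∈ range n, a i| ≤ q := by
  have hS : Function.Periodic (fun n => ∑ i ∈ range n, a i) q := fun n => by
    simp only [add_comm n q, sum_range_add, hsum, zero_add]
    exact sum_congr rfl fun i _ => by rw [add_comm, hper]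
  rw [← hS.map_mod_nat n]
  refine (abs_sum_le_sum_abs _ _).trans ((sum_le_sum fun i _ => ha i).trans ?_)
  simpa using (Nat.mod_lt n hq).le

open Filter Topology in
theorem isBigO_thetaSeries_atTop {a : ℕ → ℝ} (ha : ∀ n, |a n| ≤ 1) (ha0 : a 0 = 0) :
    (fun t => (thetaSeries a t : ℂ)) =O[atTop] fun t => Real.exp (-1 * t) := by
  have h := (tendsto_exp_mul_thetaSeries ha ha0).isBigO_one ℝ
  have h2 := (Asymptotics.isBigO_refl (fun t : ℝ => Real.exp (-1 * t)) atTop).mul h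
  refine Asymptotics.IsBigO.of_norm_left ?_
  simp only [Complex.norm_real]
  refine Asymptotics.IsBigO.norm_left ?_
  refine h2.congr (fun t => ?_) fun t => mul_one _
  rw [← mul_assoc, ← Real.exp_add]
  simp

open Filter Topology in
theorem isBigO_thetaSeries_zero {a : ℕ → ℝ} (ha : ∀ n, |a n| ≤ 1) {C : ℝ}
    (hC : ∀ n, |∑ i ∈ range n, a i| ≤ C) :
    (fun t => (thetaSeries a t : ℂ)) =O[𝓝[>] 0] fun t : ℝ => t ^ (-0 : ℝ) := by
  refine Asymptotics.IsBigO.of_bound C ?_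
  filter_upwards [self_mem_nhdsWithin] with t ht
  simpa using abs_thetaSeries_le ha hC ht

theorem locallyIntegrableOn_thetaSeries {a : ℕ → ℝ} (ha : ∀ n, |a n| ≤ 1) :
    MeasureTheory.LocallyIntegrableOn (fun t => (thetaSeries a t : ℂ)) (Set.Ioi 0) :=
  (Complex.continuous_ofReal.comp_continuousOn
    (continuousOn_thetaSeries ha)).locallyIntegrableOn measurableSet_Ioi

theorem mellinConvergent_thetaSeries {a : ℕ → ℝ} (ha : ∀ n, |a n| ≤ 1) (ha0 : a 0 = 0) {C : ℝ}
    (hC : ∀ n, |∑ i ∈ range n, a i| ≤ C) {s : ℂ} (hs : 0 < s.re) :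
    MellinConvergent (fun t => (thetaSeries a t : ℂ)) s :=
  mellinConvergent_of_isBigO_rpow_exp one_pos (locallyIntegrableOn_thetaSeries ha)
    (isBigO_thetaSeries_atTop ha ha0) (isBigO_thetaSeries_zero ha hC) hs

theorem differentiableAt_mellin_thetaSeries {a : ℕ → ℝ} (ha : ∀ n, |a n| ≤ 1) (ha0 : a 0 = 0)
    {C : ℝ} (hC : ∀ n, |∑ i ∈ range n, a i| ≤ C) {s : ℂ} (hs : 0 < s.re) :
    DifferentiableAt ℂ (mellin fun t => (thetaSeries a t : ℂ)) s :=
  mellin_differentiableAt_of_isBigO_rpow_exp one_pos (locallyIntegrableOn_thetaSeries ha)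
    (isBigO_thetaSeries_atTop ha ha0) (isBigO_thetaSeries_zero ha hC) hs

theorem mellin_thetaSeries_pos {a : ℕ → ℝ} (ha : ∀ n, |a n| ≤ 1) (ha0 : a 0 = 0) (ha1 : 0 < a 1)
    {C : ℝ} (hC : ∀ n, |∑ i ∈ range n, a i| ≤ C) (hpos : ∀ t, 0 < t → 0 ≤ thetaSeries a t)
    {s : ℝ} (hs : 0 < s) :
    ∃ r : ℝ, 0 < r ∧ mellin (fun t => (thetaSeries a t : ℂ)) s = r := by
  have hcongr : Set.EqOn (fun t : ℝ => (t : ℂ) ^ ((s : ℂ) - 1) • (thetaSeries a t : ℂ))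
      (fun t => ((t ^ (s - 1) * thetaSeries a t : ℝ) : ℂ)) (Set.Ioi 0) := fun t ht => by
    have ht' : 0 < t := ht
    simp [Complex.ofReal_cpow ht'.le]
  have hint : MeasureTheory.IntegrableOn (fun t => t ^ (s - 1) * thetaSeries a t) (Set.Ioi 0) := by
    have h := mellinConvergent_thetaSeries ha ha0 hC (s := s) (by simpa using hs)
    have h2 := (MeasureTheory.integrableOn_congr_fun hcongr measurableSet_Ioi).mp h
    exact h2.re.congr (.of_forall fun t => by simp)
  refine ⟨∫ t in Set.Ioi 0, t ^ (s - 1) * thetaSeries a t, ?_, ?_⟩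
  · rw [MeasureTheory.setIntegral_pos_iff_support_of_nonneg_ae _ hint]
    · obtain ⟨T, hT⟩ := Filter.eventually_atTop.mp
        ((tendsto_exp_mul_thetaSeries ha ha0).eventually_const_lt ha1)
      refine lt_of_lt_of_le ?_ (MeasureTheory.measure_mono (s := Set.Ioi (max T 0)) ?_)
      · simp
      · intro t ht
        obtain ⟨h1, h2⟩ := max_lt_iff.mp (Set.mem_Ioi.mp ht)
        have h3 := pos_of_mul_pos_right (hT t h1.le) (Real.exp_pos t).le
        exact ⟨(mul_pos (Real.rpow_pos_of_pos h2 _) h3).ne', h2⟩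
    · filter_upwards [MeasureTheory.ae_restrict_mem measurableSet_Ioi] with t ht
      exact mul_nonneg (Real.rpow_nonneg (le_of_lt ht) _) (hpos t ht)
  · rw [mellin, MeasureTheory.setIntegral_congr_fun measurableSet_Ioi hcongr]
    exact integral_ofReal

open Filter Topology in
/-- Truncated heat sums on long cycles, with time rescaled, converge to the theta series. -/
theorem tendsto_sum_exp_sin_sq {a : ℕ → ℝ} (ha : ∀ n, |a n| ≤ 1) {N m : ℕ → ℕ}
    (hN : Tendsto N atTop atTop) (hm : Tendsto m atTop atTop) (hmN : ∀ i, 2 * m i ≤ N i + 2)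
    {u : ℝ} (hu : 0 < u) :
    Tendsto (fun i => ∑ j ∈ range (m i), a j *
      Real.exp (-(4 * (u * N i ^ 2 / (4 * Real.pi ^ 2)) * Real.sin (Real.pi * j / N i) ^ 2)))
      atTop (𝓝 (thetaSeries a u)) := by
  have hpi := Real.pi_pos
  have hNR : Tendsto (fun i => (N i : ℝ)) atTop atTop := tendsto_natCast_atTop_atTop.comp hN
  let g : ℕ → ℕ → ℝ := fun i j => a j *
      Real.exp (-(4 * (u * N i ^ 2 / (4 * Real.pi ^ 2)) * Real.sin (Real.pi * j / N i) ^ 2))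
  have hsum : ∀ i, ∑ j ∈ range (m i), g i j = ∑' j, if j < m i then g i j else 0 := fun i => by
    rw [tsum_eq_sum (s := range (m i))]
    · exact sum_congr rfl fun j hj => (if_pos (mem_range.mp hj)).symm
    · exact fun j hj => if_neg (by simpa using hj)
  refine Tendsto.congr (fun i => (hsum i).symm) ?_
  have hc : 0 < 4 * u / Real.pi ^ 2 := by positivity
  refine tendsto_tsum_of_dominated_convergence (summable_exp_neg_sq_mul hc) (fun j => ?_) ?_
  · have h1 : Tendsto (fun i => Real.pi * j / (N i : ℝ)) atTop (𝓝 0) :=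
      hNR.const_div_atTop _
    have h2 : Tendsto (fun i => Real.sinc (Real.pi * j / (N i : ℝ))) atTop (𝓝 1) := by
      simpa [Function.comp_def] using (Real.continuous_sinc.tendsto 0).comp h1
    have h3 : Tendsto (fun i => a j *
        Real.exp (-(u * (j * Real.sinc (Real.pi * j / (N i : ℝ))) ^ 2))) atTop
        (𝓝 (a j * Real.exp (-(u * (j * 1) ^ 2)))) :=
      ((Real.continuous_exp.tendsto _).comp
        (((h2.const_mul (j : ℝ)).pow 2).const_mul u).neg).const_mul (a j)
    have h4 : a j * Real.exp (-(j : ℝ) ^ 2 * u) = a j * Real.exp (-(u * (j * 1) ^ 2)) := by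
      ring_nf
    rw [h4]
    refine h3.congr' ?_
    filter_upwards [hm.eventually_gt_atTop j, hN.eventually_gt_atTop 0] with i hi hi'
    have hNi : (N i : ℝ) ≠ 0 := by positivity
    rw [if_pos hi]
    simp only [g]
    rcases eq_or_ne j 0 with rfl | hj
    · simp
    · have hj' : (j : ℝ) ≠ 0 := by exact_mod_cast hj
      rw [Real.sinc_of_ne_zero (by positivity)]
      congr 3
      field_simp
  · refine Eventually.of_forall fun i j => ?_
    split_ifs with hj
    · refine (norm_mul_exp_le (ha j)).trans (Real.exp_le_exp.mpr ?_)
      rcases Nat.eq_zero_or_pos (N i) with h0 | hNi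
      · obtain rfl : j = 0 := by have := hmN i; omega
        simp
      have hNi' : (0 : ℝ) < N i := by exact_mod_cast hNi
      have h2j : 2 * (j : ℝ) ≤ N i := by
        have := hmN i
        exact_mod_cast (by omega : 2 * j ≤ N i)
      have hsin := Real.mul_le_sin (x := Real.pi * j / N i) (by positivity) (by
        rw [div_le_div_iff₀ hNi' two_pos]
        nlinarith)
      have h5 : 2 / Real.pi * (Real.pi * j / N i) = 2 * j / N i := by
        field_simp
      rw [h5] at hsin
      have hsq : (2 * j / N i : ℝ) ^ 2 ≤ Real.sin (Real.pi * j / N i) ^ 2 := by gcongr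
      have h6 := mul_le_mul_of_nonneg_left hsq
        (by positivity : 0 ≤ 4 * (u * N i ^ 2 / (4 * Real.pi ^ 2)))
      have h7 : 4 * (u * N i ^ 2 / (4 * Real.pi ^ 2)) * (2 * j / N i : ℝ) ^ 2 =
          (j : ℝ) ^ 2 * (4 * u / Real.pi ^ 2) := by
        field_simp
        norm_num
      linarith
    · simpa using (Real.exp_pos _).le

/-- Folding the sum over a cycle of length `N` along `j ↦ N - j`. -/
theorem sum_Ico_one_eq_fold {g : ℕ → ℝ} {N : ℕ} (hN : 0 < N) (h0 : g 0 = 0)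
    (hg : ∀ j ≤ N, g (N - j) = g j) :
    ∑ j ∈ Ico 1 N, g j = ∑ j ∈ range (N / 2 + 1), g j + ∑ j ∈ range (N - N / 2), g j := by
  have hrange : ∀ m, 0 < m → ∑ j ∈ range m, g j = ∑ j ∈ Ico 1 m, g j := fun m hm => by
    rw [range_eq_Ico, sum_eq_sum_Ico_succ_bot hm, h0, zero_add]
  rw [hrange _ (Nat.succ_pos _), hrange (N - N / 2) (by omega),
    ← sum_Ico_consecutive g (n := N / 2 + 1) (by omega) (by omega)]
  congr 1
  have h := sum_Ico_reflect g 1 (m := N - N / 2) (n := N) (by omega)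
  rw [show N + 1 - (N - N / 2) = N / 2 + 1 by omega, Nat.add_sub_cancel] at h
  rw [← h]
  refine sum_congr rfl fun j hj => hg j ?_
  have := mem_Ico.mp hj
  omega

open Filter Topology in
theorem thetaSeries_nonneg_of_heat_nonneg {a : ℕ → ℝ} (ha : ∀ n, |a n| ≤ 1) (ha0 : a 0 = 0)
    {N : ℕ → ℕ} (hN : Tendsto N atTop atTop) (hNpos : ∀ i, 0 < N i)
    (hsymm : ∀ i, ∀ j ≤ N i, a (N i - j) = a j)
    (hheat : ∀ i, ∀ t : ℝ, 0 ≤ t →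
      0 ≤ ∑ j ∈ Ico 1 (N i), a j * Real.exp (-(4 * t * Real.sin (Real.pi * j / N i) ^ 2)))
    {u : ℝ} (hu : 0 < u) : 0 ≤ thetaSeries a u := by
  have hhalf : Tendsto (fun i => N i / 2) atTop atTop :=
    (Nat.tendsto_div_const_atTop two_ne_zero).comp hN
  have h1 := tendsto_sum_exp_sin_sq ha hN (m := fun i => N i / 2 + 1)
    (tendsto_atTop_mono (fun i => Nat.le_succ _) hhalf) (fun i => by omega) hu
  have h2 := tendsto_sum_exp_sin_sq ha hN (m := fun i => N i - N i / 2)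
    (tendsto_atTop_mono (fun i => by omega) hhalf) (fun i => by omega) hu
  have h3 : 0 ≤ thetaSeries a u + thetaSeries a u := by
    refine ge_of_tendsto' (h1.add h2) fun i => ?_
    rw [← sum_Ico_one_eq_fold (hNpos i) (by simp [ha0])]
    · exact hheat i _ (by positivity)
    · intro j hj
      have hNi : (N i : ℝ) ≠ 0 := by exact_mod_cast (hNpos i).ne'
      have harg : Real.pi * ((N i - j : ℕ) : ℝ) / N i = Real.pi - Real.pi * j / N i := by
        rw [Nat.cast_sub hj]
        field_simp
      rw [hsymm i j hj, harg, Real.sin_pi_sub]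
  linarith

theorem natCast_sq_cpow_half {n : ℕ} (hn : n ≠ 0) (s : ℂ) :
    (((n : ℝ) ^ 2 : ℝ) : ℂ) ^ (s / 2) = (n : ℂ) ^ s := by
  rw [Complex.ofReal_pow, Complex.ofReal_natCast, sq, Complex.natCast_mul_natCast_cpow,
    ← Complex.cpow_add _ _ (Nat.cast_ne_zero.mpr hn), add_halves]

theorem mellin_thetaSeries_eq_Gamma_mul_LSeries {a : ℕ → ℝ} (ha : ∀ n, |a n| ≤ 1)
    (ha0 : a 0 = 0) {s : ℂ} (hs : 1 < s.re) :
    mellin (fun t => (thetaSeries a t : ℂ)) (s / 2) =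
      Complex.Gamma (s / 2) * LSeries (fun n => (a n : ℂ)) s := by
  have hre : (s / 2).re = s.re / 2 := by simp
  have h := hasSum_mellin (a := fun n : ℕ => (a n : ℂ)) (p := fun n : ℕ => (n : ℝ) ^ 2)
    (F := fun t => (thetaSeries a t : ℂ)) (s := s / 2) (fun n => ?_) (by rw [hre]; linarith)
    (fun t ht => ?_) ?_
  · rw [← h.tsum_eq, LSeries, ← tsum_mul_left]
    refine tsum_congr fun n => ?_
    rw [LSeries.term_def]
    split_ifs with hn
    · simp [hn, ha0]
    · rw [natCast_sq_cpow_half hn, mul_div_assoc]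
  · rcases Nat.eq_zero_or_pos n with rfl | hn
    · simp [ha0]
    · exact Or.inr (by positivity)
  · have := Complex.hasSum_ofReal.mpr (hasSum_thetaSeries ha ht)
    simpa only [Complex.ofReal_mul] using this
  · refine (Real.summable_one_div_nat_rpow.mpr hs).of_nonneg_of_le (fun n => by positivity)
      fun n => ?_
    have hpow : ((n : ℝ) ^ 2) ^ (s / 2).re = (n : ℝ) ^ s.re := by
      rw [hre, ← Real.rpow_natCast, ← Real.rpow_mul n.cast_nonneg]
      congr 1
      push_cast
      ring
    rw [hpow, Complex.norm_real]
    exact div_le_div_of_nonneg_right (ha n) (by positivity)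

namespace DirichletCharacter

variable {q : ℕ} (χ : DirichletCharacter ℂ q)

theorem ofReal_re_apply (hreal : ∀ x : ZMod q, (χ x).im = 0) (x : ZMod q) :
    ((χ x).re : ℂ) = χ x :=
  Complex.ext rfl (by simp [hreal x])

theorem abs_re_apply_le_one (x : ZMod q) : |(χ x).re| ≤ 1 :=
  (Complex.abs_re_le_norm _).trans (χ.norm_le_one x)

theorem map_zero_of_one_lt (hq : 1 < q) : χ 0 = 0 := by
  have : Fact (1 < q) := ⟨hq⟩
  exact χ.map_nonunit not_isUnit_zero

theorem abs_sum_range_re_le [NeZero q] (hχ : χ ≠ 1) (n : ℕ) :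
    |∑ i ∈ range n, (χ (i : ZMod q)).re| ≤ q := by
  refine abs_sum_range_le_of_periodic (fun i => χ.abs_re_apply_le_one i)
    (Nat.pos_of_ne_zero (NeZero.ne q)) (fun i => by simp) ?_ n
  have h : ∑ i ∈ range q, χ (i : ZMod q) = ∑ x : ZMod q, χ x := by
    refine sum_bij' (fun i _ => (i : ZMod q)) (fun x _ => x.val) ?_ ?_ ?_ ?_ ?_
    · simp
    · exact fun x _ => mem_range.mpr x.val_lt
    · exact fun i hi => ZMod.val_cast_of_lt (mem_range.mp hi)
    · simp
    · simp
  rw [← Complex.re_sum, h, MulChar.sum_eq_zero_of_ne_one hχ, Complex.zero_re]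

theorem mellin_thetaSeries_eq_Gamma_mul_LFunction [NeZero q] (hq : 1 < q) (hχ : χ ≠ 1)
    (hreal : ∀ x : ZMod q, (χ x).im = 0) {s : ℂ} (hs : 0 < s.re) :
    mellin (fun t => (thetaSeries (fun n => (χ (n : ZMod q)).re) t : ℂ)) (s / 2) =
      Complex.Gamma (s / 2) * LFunction χ s := by
  set a : ℕ → ℝ := fun n => (χ (n : ZMod q)).re
  have ha : ∀ n, |a n| ≤ 1 := fun n => χ.abs_re_apply_le_one n
  have ha0 : a 0 = 0 := by simp [a, χ.map_zero_of_one_lt hq]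
  have hU : IsOpen {z : ℂ | 0 < z.re} := isOpen_lt continuous_const Complex.continuous_re
  have hhalf : ∀ z : ℂ, 0 < z.re → 0 < (z / 2).re := fun z hz => by simpa using hz
  have hdiv : Differentiable ℂ fun z : ℂ => z / 2 := by fun_prop
  have hF : AnalyticOnNhd ℂ (fun z => mellin (fun t => (thetaSeries a t : ℂ)) (z / 2))
      {z | 0 < z.re} :=
    DifferentiableOn.analyticOnNhd (fun z hz =>
      (DifferentiableAt.comp z (differentiableAt_mellin_thetaSeries ha ha0
        (χ.abs_sum_range_re_le hχ) (hhalf z hz)) (hdiv z)).differentiableWithinAt) hU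
  have hG : AnalyticOnNhd ℂ (fun z => Complex.Gamma (z / 2) * LFunction χ z) {z | 0 < z.re} := by
    refine DifferentiableOn.analyticOnNhd (fun z hz => ?_) hU
    have hΓ : DifferentiableAt ℂ Complex.Gamma (z / 2) :=
      Complex.differentiableAt_Gamma _ fun m hm => by
        have := hhalf z hz
        rw [hm, Complex.neg_re, Complex.natCast_re] at this
        linarith [(m.cast_nonneg : (0 : ℝ) ≤ m)]
    exact ((DifferentiableAt.comp z hΓ (hdiv z)).mul
      (differentiable_LFunction hχ z)).differentiableWithinAt
  refine hF.eqOn_of_preconnected_of_eventuallyEq hG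
    (convex_halfSpace_re_gt 0).isPreconnected (z₀ := 2) (by simp) ?_ hs
  filter_upwards [(isOpen_lt continuous_const Complex.continuous_re).mem_nhds
    (by simp : (2 : ℂ) ∈ {z : ℂ | 1 < z.re})] with z hz
  rw [mellin_thetaSeries_eq_Gamma_mul_LSeries ha ha0 hz, LFunction_eq_LSeries χ hz]
  simp only [a, χ.ofReal_re_apply hreal]

end DirichletCharacter

theorem heat_positive_implies_no_real_zeros {q : ℕ} [NeZero q] (hq : 1 < q)
    (χ : DirichletCharacter ℂ q) (hprim : χ.IsPrimitive) (hχ : χ (-1) = 1)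
    (hreal : ∀ x : ZMod q, (χ x).im = 0)
    (hheat : ∃ f : ℕ → ℕ, StrictMono f ∧ (∀ i, 0 < f i) ∧
      ∀ i, ∀ t : ℝ, 0 ≤ t →
        ∃ r : ℝ, 0 ≤ r ∧
          ∑ j ∈ Finset.Ico 1 (q * f i),
            χ (j : ZMod q) *
              (Real.exp (-(4 * t * Real.sin (Real.pi * j / (q * f i)) ^ 2)) : ℂ) = (r : ℂ)) :
    ∀ s : ℝ, 0 < s → s < 1 →
      ∃ r : ℝ, 0 < r ∧ DirichletCharacter.LFunction χ (s : ℂ) = (r : ℂ) := by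
  intro s hs _
  have hne : χ ≠ 1 := by
    rintro rfl
    rw [DirichletCharacter.isPrimitive_def, DirichletCharacter.conductor_one] at hprim
    omega
  obtain ⟨f, hf, hfpos, hheat⟩ := hheat
  have ha : ∀ n : ℕ, |(χ (n : ZMod q)).re| ≤ 1 := fun n => χ.abs_re_apply_le_one n
  have ha0 : (χ ((0 : ℕ) : ZMod q)).re = 0 := by simp [χ.map_zero_of_one_lt hq]
  have hpos : ∀ t, 0 < t → 0 ≤ thetaSeries (fun n => (χ (n : ZMod q)).re) t := by
    refine fun t ht => thetaSeries_nonneg_of_heat_nonneg ha ha0 (N := fun i => q * f i)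
      (Filter.tendsto_atTop_mono (fun i => Nat.le_mul_of_pos_left _ (by omega))
        hf.tendsto_atTop) (fun i => Nat.mul_pos (by omega) (hfpos i)) (fun i j hj => ?_)
      (fun i t ht => ?_) ht
    · have hneg : χ (-(j : ZMod q)) = χ j := by
        rw [neg_eq_neg_one_mul, map_mul, hχ, one_mul]
      simp [Nat.cast_sub hj, hneg]
    · obtain ⟨r, hr, h⟩ := hheat i t ht
      have h2 : ∑ j ∈ Ico 1 (q * f i), (χ (j : ZMod q)).re *
          Real.exp (-(4 * t * Real.sin (Real.pi * j / (q * f i : ℕ)) ^ 2)) = r := by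
        rw [← Complex.ofReal_inj, ← h]
        push_cast
        simp only [χ.ofReal_re_apply hreal]
      rwa [h2]
  obtain ⟨r, hr, h⟩ := mellin_thetaSeries_pos ha ha0 (by simp) (χ.abs_sum_range_re_le hne) hpos
    (half_pos hs)
  have hL := χ.mellin_thetaSeries_eq_Gamma_mul_LFunction hq hne hreal (s := s) (by simpa using hs)
  have hΓ := Real.Gamma_pos_of_pos (half_pos hs)
  have hcast : ((s / 2 : ℝ) : ℂ) = (s : ℂ) / 2 := by push_cast; ring
  rw [← hcast, h, Complex.Gamma_ofReal] at hL
  refine ⟨r / Real.Gamma (s / 2), div_pos hr hΓ, ?_⟩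
  rw [Complex.ofReal_div, hL, mul_div_cancel_left₀ _ (Complex.ofReal_ne_zero.mpr hΓ.ne')]
end

section
/- Let q > 1 and let χ be a primitive, real, even Dirichlet character of conductor q (i.e. χ is primitive, χ(-1) = 1, and all values of χ are real). Let n ≥ 1 be an integer and let t > 0 be real. If either t < n²/(2·log 2) or t > q²·n²·log 2/(4·(16 − π²)), then ∑_{j=1}^{qn−1} χ(j)·e^{−4t sin²(πj/(qn))} ≥ 0 (the sum being real since χ is real). -/
open Finset

open Polynomial in
theorem sum_eval_eq_neg_coeff {F : Type*} [Field F] [Fintype F] {f : F[X]}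
    (hf : f.natDegree ≤ Fintype.card F - 1) :
    ∑ x, f.eval x = -f.coeff (Fintype.card F - 1) := by
  have hpow : ∑ x : F, x ^ (Fintype.card F - 1) = -1 := by
    classical
    rw [← Finset.sum_erase_add _ _ (mem_univ (0 : F)),
      Finset.sum_congr rfl fun x hx => FiniteField.pow_card_sub_one_eq_one x (ne_of_mem_erase hx),
      zero_pow (Nat.sub_ne_zero_of_lt Fintype.one_lt_card)]
    simp [card_erase_of_mem, Nat.cast_sub Fintype.card_pos]
  simp_rw [eval_eq_sum_range' (Nat.lt_succ_of_le hf)]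
  rw [sum_comm, sum_range_succ, sum_eq_zero, ← mul_sum, hpow]
  · ring
  · intro i hi
    rw [← mul_sum, FiniteField.sum_pow_lt_card_sub_one F i (mem_range.mp hi), mul_zero]

theorem sum_zmod_eq_sum_range {M : Type*} [AddCommMonoid M] (p : ℕ) [NeZero p] (f : ZMod p → M) :
    ∑ x, f x = ∑ j ∈ range p, f j := by
  refine (sum_nbij' (fun j : ℕ => (j : ZMod p)) ZMod.val ?_ ?_ ?_ ?_ ?_).symm
  · simp
  · intro x _; exact mem_range.mpr (ZMod.val_lt x)
  · intro j hj; exact ZMod.val_cast_of_lt (mem_range.mp hj)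
  · simp
  · simp

open Polynomial in
theorem factorial_mul_coeff_taylor_sum_pow {p h : ℕ} [Fact p.Prime] (hp : p = 2 * h + 1) :
    (h.factorial : ZMod p) *
      (taylor 1 (∑ j ∈ range p, C ((j : ZMod p) ^ h) * X ^ j)).coeff h = -1 := by
  set f : (ZMod p)[X] := X ^ h * descPochhammer (ZMod p) h with hf
  have hmonic : f.Monic := (monic_X_pow h).mul (monic_descPochhammer _ h)
  have hdeg : f.natDegree = p - 1 := by
    rw [hf, (monic_X_pow h).natDegree_mul (monic_descPochhammer _ h),
      descPochhammer_natDegree, natDegree_X_pow]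
    omega
  have key := sum_eval_eq_neg_coeff (F := ZMod p) (f := f) (by rw [ZMod.card, hdeg])
  rw [ZMod.card, ← hdeg, coeff_natDegree, hmonic.leadingCoeff, sum_zmod_eq_sum_range] at key
  rw [← key, map_sum, finsetSum_coeff, mul_sum]
  refine sum_congr rfl fun j _ => ?_
  rw [taylor_mul, taylor_C, taylor_X_pow, coeff_C_mul, C_1, coeff_X_add_one_pow, hf, eval_mul,
    eval_pow, eval_X, descPochhammer_eval_eq_descFactorial, Nat.descFactorial_eq_factorial_mul_choose]
  push_cast
  ring

open Polynomial in
theorem coeff_taylor_prod {R : Type*} [CommRing R] (h : ℕ) :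
    (taylor 1 (∏ a ∈ range h, (X ^ ((a + 1) * h) * (X ^ (a + 1) - 1)) : R[X])).coeff h =
      h.factorial := by
  have hfac : ∀ a : ℕ, ∃ g : R[X], (X + 1 : R[X]) ^ a - 1 = X * g ∧ g.coeff 0 = a := by
    intro a
    refine ⟨divX ((X + 1 : R[X]) ^ a), ?_, ?_⟩
    · nth_rewrite 1 [← X_mul_divX_add ((X + 1 : R[X]) ^ a)]
      simp [coeff_X_add_one_pow]
    · simp [coeff_divX, coeff_X_add_one_pow]
  choose g hg hg0 using hfac
  have : taylor 1 (∏ a ∈ range h, (X ^ ((a + 1) * h) * (X ^ (a + 1) - 1)) : R[X]) =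
      X ^ h * ∏ a ∈ range h, ((X + 1) ^ ((a + 1) * h) * g (a + 1)) := by
    change taylorAlgHom (1 : R) _ = _
    rw [map_prod]
    simp only [taylorAlgHom_apply, taylor_mul, taylor_X_pow, map_sub, taylor_one, C_1, hg]
    rw [prod_mul_distrib, prod_mul_distrib, prod_mul_distrib, prod_const, card_range]
    ring
  rw [this, coeff_X_pow_mul', if_pos le_rfl, Nat.sub_self, coeff_zero_eq_eval_zero, eval_prod,
    ← prod_range_add_one_eq_factorial, Nat.cast_prod]
  refine prod_congr rfl fun a _ => ?_
  simp [← coeff_zero_eq_eval_zero, hg0]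

theorem neg_one_pow_mul_factorial_sq {p h : ℕ} [Fact p.Prime] (hp : p = 2 * h + 1) :
    (-1 : ZMod p) ^ h * (h.factorial : ZMod p) ^ 2 = -1 := by
  have hw := ZMod.wilsons_lemma p
  have h1 : p - 1 = h + h := by omega
  rw [h1, ← Nat.factorial_mul_ascFactorial, Nat.ascFactorial_eq_prod_range,
    ← prod_range_reflect] at hw
  push_cast at hw
  suffices hs : (-1 : ZMod p) ^ h * h.factorial = ∏ j ∈ range h, ((h : ZMod p) + 1 + (h - 1 - j : ℕ)) by
    rw [sq, ← mul_assoc, hs, mul_comm, hw]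
  have hneg : (-1 : ZMod p) ^ h = ∏ _i ∈ range h, (-1 : ZMod p) := by simp
  rw [← prod_range_add_one_eq_factorial, Nat.cast_prod, hneg, ← prod_mul_distrib]
  refine prod_congr rfl fun i hi => ?_
  have hi' := mem_range.mp hi
  have : ((h + 1 + (h - 1 - i) + (i + 1) : ℕ) : ZMod p) = 0 := by
    rw [show h + 1 + (h - 1 - i) + (i + 1) = p by omega]; simp
  push_cast at this ⊢
  linear_combination -this

open Complex in
theorem exp_pow_mul_sub_one {p h : ℕ} (hp : p = 2 * h + 1) (a : ℕ) :
    exp (2 * Real.pi * I / p) ^ (a * h) * (exp (2 * Real.pi * I / p) ^ a - 1) =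
      (-1) ^ a * I * ((2 * Real.sin (Real.pi * a / p) : ℝ) : ℂ) := by
  have hp0 : (p : ℂ) ≠ 0 := by
    rw [hp]; exact_mod_cast Nat.succ_ne_zero (2 * h)
  set w : ℂ := exp (Real.pi * a / p * I) with hw
  have hw0 : w ≠ 0 := exp_ne_zero _
  have h1 : exp (2 * Real.pi * I / p) ^ a = w ^ 2 := by
    rw [hw, ← exp_nat_mul, ← exp_nat_mul]; congr 1; push_cast; ring
  have h2 : w ^ (2 * h + 1) = (-1) ^ a := by
    rw [hw, ← exp_nat_mul, ← hp, ← exp_pi_mul_I, ← exp_nat_mul]; congr 1; field_simp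
  have h3 : ((2 * Real.sin (Real.pi * a / p) : ℝ) : ℂ) = (w⁻¹ - w) * I := by
    rw [hw, ← exp_neg]
    push_cast
    rw [sin, neg_mul]
    ring
  rw [pow_mul, h1, h3, ← h2]
  have : w * w⁻¹ = 1 := mul_inv_cancel₀ hw0
  rw [← pow_mul]
  linear_combination (-w ^ (2 * h) * I ^ 2) * this + (w ^ (2 * h) * (w ^ 2 - 1)) * I_sq

open Complex in
theorem norm_one_sub_exp_pow {p a : ℕ} (ha : a ≤ p) :
    ‖1 - exp (2 * Real.pi * I / p) ^ a‖ = 2 * Real.sin (Real.pi * a / p) := by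
  have := norm_exp_I_mul_ofReal_sub_one (2 * Real.pi * a / p)
  rw [norm_sub_rev, ← exp_nat_mul]
  convert this using 1
  · congr 3; push_cast; ring
  · rw [Real.norm_of_nonneg]
    · congr 2; ring
    · refine mul_nonneg zero_le_two (Real.sin_nonneg_of_nonneg_of_le_pi (by positivity) ?_)
      rcases Nat.eq_zero_or_pos p with rfl | h
      · simp [Real.pi_pos.le]
      · rw [show 2 * Real.pi * a / p / 2 = Real.pi * (a / p) by ring]
        exact mul_le_of_le_one_right Real.pi_pos.le ((div_le_one (by positivity)).mpr (by exact_mod_cast ha))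

theorem prod_two_mul_sin {p h : ℕ} (hp : p = 2 * h + 1) :
    ∏ a ∈ range h, (2 * Real.sin (Real.pi * (a + 1 : ℕ) / p)) = √p := by
  have hp0 : 0 < (p : ℝ) := by rw [hp]; positivity
  have hprod := (Complex.isPrimitiveRoot_exp (2 * h + 1) (by omega)).prod_one_sub_pow_eq_order
  rw [← hp] at hprod
  replace hprod := congrArg norm hprod
  rw [norm_prod, prod_congr rfl fun k hk => norm_one_sub_exp_pow (p := p) (a := k + 1)
      (by have := mem_range.mp hk; omega), two_mul, prod_range_add] at hprod
  rw [← prod_range_reflect (fun x => 2 * Real.sin (Real.pi * ((h + x + 1 : ℕ) : ℝ) / p)),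
    prod_congr (s₁ := range h) (s₂ := range h)
      (f := fun j => 2 * Real.sin (Real.pi * ((h + (h - 1 - j) + 1 : ℕ) : ℝ) / p))
      (g := fun a => 2 * Real.sin (Real.pi * (a + 1 : ℕ) / p)) rfl] at hprod
  · symm
    rw [Real.sqrt_eq_iff_mul_self_eq hp0.le, hprod]
    · rw [hp]; push_cast
      norm_cast
      omega
    · refine prod_nonneg fun a ha => mul_nonneg zero_le_two
        (Real.sin_nonneg_of_nonneg_of_le_pi (by positivity) ?_)
      rw [mul_div_assoc]
      refine mul_le_of_le_one_right Real.pi_pos.le ((div_le_one hp0).mpr ?_)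
      have := mem_range.mp ha
      exact_mod_cast (by omega : a + 1 ≤ p)
  · intro j hj
    have hj' := mem_range.mp hj
    rw [← Real.sin_pi_sub]
    congr 2
    have : ((h + (h - 1 - j) + 1 : ℕ) : ℝ) = p - (j + 1 : ℕ) := by
      rw [eq_sub_iff_add_eq]; exact_mod_cast (by omega)
    rw [this]
    field_simp
    ring
open Polynomial in
theorem cyclotomic_dvd_taylor {p : ℕ} [Fact p.Prime] {f : ℤ[X]} {ζ : ℂ}
    (hζ : IsPrimitiveRoot ζ p) (hf : aeval ζ f = 0) {i : ℕ} (hi : i < p - 1) :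
    (taylor 1 (f.map (Int.castRingHom (ZMod p)))).coeff i = 0 := by
  have hpos : 0 < p := (Fact.out : p.Prime).pos
  have hdvd : cyclotomic p ℤ ∣ f := by
    rw [cyclotomic_eq_minpoly hζ hpos]
    exact minpoly.isIntegrallyClosed_dvd (hζ.isIntegral hpos) hf
  have hcyc : cyclotomic p (ZMod p) = (X - 1) ^ (p - 1) := by
    have h1 := cyclotomic_prime_mul_X_sub_one (ZMod p) p
    have h2 : (X ^ p - 1 : (ZMod p)[X]) = (X - 1) ^ (p - 1) * (X - 1) := by
      rw [← pow_succ, Nat.sub_add_cancel hpos, sub_pow_char, one_pow]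
    rw [h2] at h1
    exact mul_right_cancel₀ (X_sub_C_ne_zero (1 : ZMod p)) h1
  obtain ⟨g, hg⟩ := Polynomial.map_dvd (Int.castRingHom (ZMod p)) hdvd
  rw [map_cyclotomic, hcyc] at hg
  rw [hg, taylor_mul, taylor_pow, map_sub, taylor_X, taylor_one, C_1, add_sub_cancel_right,
    coeff_X_pow_mul', if_neg (by omega)]

open Polynomial in
theorem gaussSum_quadraticChar {p h : ℕ} [Fact p.Prime] (hp : p = 2 * h + 1) :
    gaussSum ((quadraticChar (ZMod p)).ringHomComp (Int.castRingHom ℂ)) ZMod.stdAddChar =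
      Complex.I ^ h ^ 2 * √p := by
  have hp2 : p ≠ 2 := by omega
  have hchar : ringChar (ZMod p) ≠ 2 := by rwa [ZMod.ringChar_zmod_n]
  have hprime : p.Prime := Fact.out
  set ζ : ℂ := Complex.exp (2 * Real.pi * Complex.I / p) with hζdef
  have hζ : IsPrimitiveRoot ζ p := Complex.isPrimitiveRoot_exp p hprime.ne_zero
  set χ := (quadraticChar (ZMod p)).ringHomComp (Int.castRingHom ℂ) with hχ
  set A : ℤ[X] := ∑ j ∈ range p, C (quadraticChar (ZMod p) j) * X ^ j with hA
  set B : ℤ[X] := ∏ a ∈ range h, (X ^ ((a + 1) * h) * (X ^ (a + 1) - 1)) with hB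
  have hAζ : aeval ζ A = gaussSum χ ZMod.stdAddChar := by
    rw [gaussSum, sum_zmod_eq_sum_range, hA, map_sum]
    refine sum_congr rfl fun j _ => ?_
    have : (ZMod.stdAddChar (j : ZMod p) : ℂ) = ζ ^ j := by
      have := ZMod.stdAddChar_coe (N := p) j
      rw [Int.cast_natCast] at this
      rw [this, hζdef, ← Complex.exp_nat_mul]
      congr 1; push_cast; ring
    rw [this]
    simp [hχ, MulChar.ringHomComp_apply]
  have hBζ : aeval ζ B = (-1) ^ (h * (h + 1) / 2) * Complex.I ^ h * √p := by
    rw [hB, map_prod, ← prod_two_mul_sin hp]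
    simp only [map_mul, map_sub, map_pow, aeval_X, map_one, hζdef, exp_pow_mul_sub_one hp]
    rw [prod_mul_distrib, prod_mul_distrib, prod_const, card_range, prod_pow_eq_pow_sum,
      Complex.ofReal_prod]
    congr 3
    have h1 := Finset.sum_range_id (h + 1)
    rw [Finset.sum_range_succ'] at h1
    simpa [mul_comm] using h1
  have hchi : ∀ a : ZMod p, ((quadraticChar (ZMod p) a : ℤ) : ZMod p) = a ^ h := by
    intro a
    rw [quadraticChar_eq_pow_of_char_ne_two' hchar, ZMod.card]
    congr 1
    omega
  have hsq : aeval ζ A ^ 2 = aeval ζ B ^ 2 := by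
    have hne : χ ≠ 1 := by
      rw [hχ, MulChar.ringHomComp_ne_one_iff Int.cast_injective]
      exact quadraticChar_ne_one hchar
    have h1 := gaussSum_sq hne
      ((quadraticChar_isQuadratic (ZMod p)).comp _) (ZMod.isPrimitive_stdAddChar p)
    have hneg : quadraticChar (ZMod p) (-1) = (-1) ^ h := by
      rw [quadraticChar_neg_one hchar, ZMod.card, ZMod.χ₄_eq_neg_one_pow (by omega)]
      congr 1; omega
    have h2 : χ (-1) = (-1) ^ h := by
      rw [hχ, MulChar.ringHomComp_apply, hneg]; simp
    rw [hAζ, h1, hBζ, h2, ZMod.card, mul_pow, mul_pow, ← pow_mul, mul_comm _ 2, pow_mul, neg_one_sq,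
      one_pow, one_mul, ← pow_mul, mul_comm h 2, pow_mul, Complex.I_sq]
    norm_cast
    rw [Real.sq_sqrt (Nat.cast_nonneg p)]
    norm_cast
  have key : ∀ ε : ℤ, aeval ζ A = ε * aeval ζ B → (ε : ZMod p) = (-1) ^ h := by
    intro ε hε
    have h0 := cyclotomic_dvd_taylor (f := A - C ε * B) (i := h) hζ (by simp [hε])
      (by have := hprime.two_le; omega)
    have hmA : A.map (Int.castRingHom (ZMod p)) = ∑ j ∈ range p, C ((j : ZMod p) ^ h) * X ^ j := by
      rw [hA, Polynomial.map_sum]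
      refine sum_congr rfl fun j _ => ?_
      rw [Polynomial.map_mul, map_C, Polynomial.map_pow, map_X, eq_intCast, hchi]
    have hmB : B.map (Int.castRingHom (ZMod p)) =
        ∏ a ∈ range h, (X ^ ((a + 1) * h) * (X ^ (a + 1) - 1)) := by
      rw [hB, Polynomial.map_prod]
      simp
    rw [Polynomial.map_sub, Polynomial.map_mul, map_C, map_sub, taylor_mul, taylor_C, coeff_sub,
      coeff_C_mul, hmA, hmB, coeff_taylor_prod, sub_eq_zero, eq_intCast] at h0
    have h1 := factorial_mul_coeff_taylor_sum_pow hp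
    rw [h0, ← neg_one_pow_mul_factorial_sq hp] at h1
    have h2 : (h.factorial : ZMod p) ≠ 0 := by
      rw [Ne, ZMod.natCast_eq_zero_iff, hprime.dvd_factorial]; omega
    refine mul_right_cancel₀ (pow_ne_zero 2 h2) ?_
    rw [← h1]; ring
  have hsign : aeval ζ A = (-1) ^ h * aeval ζ B := by
    have hone : (1 : ZMod p) ≠ -1 :=
      haveI : Fact (2 < p) := ⟨by have := hprime.two_le; omega⟩
      ZMod.neg_one_ne_one.symm
    rcases sq_eq_sq_iff_eq_or_eq_neg.mp hsq with h1 | h1 <;> rcases Nat.even_or_odd h with he | ho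
    · rw [he.neg_one_pow, one_mul, h1]
    · have := key 1 (by simpa using h1)
      rw [ho.neg_one_pow, Int.cast_one] at this
      exact absurd this hone
    · have := key (-1) (by simpa using h1)
      rw [he.neg_one_pow, Int.cast_neg, Int.cast_one] at this
      exact absurd this.symm hone
    · rw [ho.neg_one_pow, neg_one_mul, h1]
  rw [← hAζ, hsign, hBζ, ← mul_assoc, ← mul_assoc, ← Complex.I_sq, ← pow_mul, ← pow_mul, ← pow_add,
    ← pow_add, Nat.mul_div_cancel' (Nat.even_mul_succ_self h).two_dvd,
    show 2 * h + h * (h + 1) + h = h ^ 2 + 4 * h by ring, pow_add, pow_mul Complex.I 4,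
    Complex.I_pow_four, one_pow, mul_one]

section Splitting

variable {R S T C : Type*} [CommRing R] [CommRing S] [CommRing T] [CommRing C]

/-- The restriction of a multiplicative character of `R ≅ S × T` to the first factor. -/
def MulChar.splitLeft (e : R ≃+* S × T) (χ : MulChar R C) : MulChar S C where
  toFun s := χ (e.symm (s, 1))
  map_one' := by rw [← Prod.one_eq_mk, map_one, map_one]
  map_mul' a b := by rw [← map_mul, ← map_mul, Prod.mk_mul_mk, one_mul]
  map_nonunit' a ha := χ.map_nonunit fun h => ha (by
    simpa using ((MulEquiv.isUnit_map e.symm).mp h).map (RingHom.fst S T))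

/-- The restriction of a multiplicative character of `R ≅ S × T` to the second factor. -/
def MulChar.splitRight (e : R ≃+* S × T) (χ : MulChar R C) : MulChar T C where
  toFun t := χ (e.symm (1, t))
  map_one' := by rw [← Prod.one_eq_mk, map_one, map_one]
  map_mul' a b := by rw [← map_mul, ← map_mul, Prod.mk_mul_mk, one_mul]
  map_nonunit' a ha := χ.map_nonunit fun h => ha (by
    simpa using ((MulEquiv.isUnit_map e.symm).mp h).map (RingHom.snd S T))

theorem MulChar.splitLeft_mul_splitRight (e : R ≃+* S × T) (χ : MulChar R C) (s : S) (t : T) :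
    χ.splitLeft e s * χ.splitRight e t = χ (e.symm (s, t)) := by
  change χ (e.symm (s, 1)) * χ (e.symm (1, t)) = _
  rw [← map_mul, ← map_mul, Prod.mk_mul_mk, one_mul, mul_one]

end Splitting

theorem gaussSum_eq_split {N M : ℕ} [NeZero N] [NeZero M] (h : N.Coprime M)
    (χ : DirichletCharacter ℂ (N * M)) :
    gaussSum χ ZMod.stdAddChar =
      χ.splitLeft (ZMod.chineseRemainder h) M * χ.splitRight (ZMod.chineseRemainder h) N *
      (gaussSum (χ.splitLeft (ZMod.chineseRemainder h)) ZMod.stdAddChar *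
        gaussSum (χ.splitRight (ZMod.chineseRemainder h)) ZMod.stdAddChar) := by
  set e := ZMod.chineseRemainder h
  let E : ZMod N × ZMod M ≃ ZMod (N * M) :=
    ((Units.mulLeft (ZMod.unitOfCoprime M h.symm)).prodCongr
      (Units.mulLeft (ZMod.unitOfCoprime N h))).trans e.symm.toEquiv
  have hE : ∀ a b, E (a, b) = e.symm (M * a, N * b) := fun a b => by
    simp [E]
  have hadd : ∀ a b, (ZMod.stdAddChar (E (a, b)) : ℂ) = ZMod.stdAddChar a * ZMod.stdAddChar b := by
    intro a b
    obtain ⟨x, rfl⟩ := ZMod.intCast_surjective a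
    obtain ⟨y, rfl⟩ := ZMod.intCast_surjective b
    have : E (x, y) = ((M * x + N * y : ℤ) : ZMod (N * M)) := by
      rw [hE, RingEquiv.symm_apply_eq, map_intCast]
      ext <;> simp
    rw [this, ZMod.stdAddChar_coe, ZMod.stdAddChar_coe, ZMod.stdAddChar_coe, ← Complex.exp_add]
    congr 1
    have hN : (N : ℂ) ≠ 0 := NeZero.ne _
    have hM : (M : ℂ) ≠ 0 := NeZero.ne _
    push_cast
    field_simp
  rw [gaussSum, gaussSum, gaussSum, ← E.sum_comp, Fintype.sum_prod_type, Finset.sum_mul_sum, mul_sum]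
  refine sum_congr rfl fun a _ => ?_
  rw [mul_sum]
  refine sum_congr rfl fun b _ => ?_
  rw [hadd, hE, ← MulChar.splitLeft_mul_splitRight, map_mul, map_mul]
  ring

theorem DirichletCharacter.IsPrimitive.exists_unit {N d : ℕ} [NeZero N]
    {χ : DirichletCharacter ℂ N} (hχ : χ.IsPrimitive) (hd : d ∣ N) (hdN : d ≠ N) :
    ∃ u : (ZMod N)ˣ, ZMod.castHom hd (ZMod d) u = 1 ∧ χ u ≠ 1 := by
  by_contra! H
  have hf : χ.FactorsThrough d := by
    rw [factorsThrough_iff_ker_unitsMap hd]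
    intro u hu
    rw [MonoidHom.mem_ker] at hu ⊢
    ext
    rw [MulChar.coe_toUnitHom]
    exact H u (by simpa [ZMod.unitsMap] using congrArg Units.val hu)
  have h1 := χ.conductor_dvd_of_mem_conductorSet hf
  rw [(isPrimitive_def χ).mp hχ] at h1
  exact hdN (Nat.dvd_antisymm hd h1)

theorem DirichletCharacter.isPrimitive_of_exists_unit {N : ℕ} [NeZero N]
    {χ : DirichletCharacter ℂ N}
    (H : ∀ d (hd : d ∣ N), d ≠ N → ∃ u : (ZMod N)ˣ, ZMod.castHom hd (ZMod d) u = 1 ∧ χ u ≠ 1) :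
    χ.IsPrimitive := by
  by_contra hne
  obtain ⟨u, hu, hχu⟩ := H χ.conductor χ.conductor_dvd_level hne
  refine hχu ?_
  have hk := (factorsThrough_iff_ker_unitsMap χ.conductor_dvd_level).mp χ.factorsThrough_conductor
  have : u ∈ χ.toUnitHom.ker := hk (by
    rw [MonoidHom.mem_ker]
    ext
    simpa [ZMod.unitsMap] using hu)
  rw [← MulChar.coe_toUnitHom, MonoidHom.mem_ker.mp this, Units.val_one]

theorem MulChar.IsQuadratic.apply_sq_eq_one {R : Type*} [CommRing R] {χ : MulChar R ℂ}
    (hχ : χ.IsQuadratic) {a : R} (ha : IsUnit a) : χ a ^ 2 = 1 := by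
  rcases hχ a with h | h | h
  · exact absurd (ha.map χ) (by simp [h])
  · simp [h]
  · simp [h]

theorem DirichletCharacter.IsPrimitive.exists_forall_sq_ne {N d : ℕ} [NeZero N]
    {χ : DirichletCharacter ℂ N} (hχ : χ.IsPrimitive) (hquad : χ.IsQuadratic)
    (hd : d ∣ N) (hdN : d ≠ N) : ∃ j : ℤ, ∀ v : ZMod N, v ^ 2 ≠ 1 + d * j := by
  obtain ⟨u, hu, hχu⟩ := hχ.exists_unit hd hdN
  obtain ⟨x, hx⟩ := ZMod.intCast_surjective (u : ZMod N)
  rw [← hx, map_intCast, ← sub_eq_zero, ← Int.cast_one, ← Int.cast_sub,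
    ZMod.intCast_zmod_eq_zero_iff_dvd] at hu
  obtain ⟨j, hj⟩ := hu
  refine ⟨j, fun v hv => hχu ?_⟩
  have : v ^ 2 = u := by
    rw [hv, ← hx, sub_eq_iff_eq_add'.mp hj]; simp
  rw [← this, map_pow]
  exact hquad.apply_sq_eq_one (IsUnit.of_pow_eq_one (n := 2 * orderOf u) (by
    rw [pow_mul, this, ← Units.val_pow_eq_pow_val, pow_orderOf_eq_one, Units.val_one])
    (mul_ne_zero two_ne_zero (orderOf_pos u).ne'))

theorem DirichletCharacter.IsPrimitive.not_sq_dvd {N p : ℕ} [NeZero N]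
    {χ : DirichletCharacter ℂ N} (hχ : χ.IsPrimitive) (hquad : χ.IsQuadratic)
    (hp : p.Prime) (hp2 : p ≠ 2) : ¬ p ^ 2 ∣ N := by
  rintro ⟨m, rfl⟩
  obtain ⟨j, hj⟩ := hχ.exists_forall_sq_ne hquad (d := p * m) ⟨p, by ring⟩ (by
    intro h
    have hm : m ≠ 0 := fun h => NeZero.ne (p ^ 2 * m) (by simp [h])
    have := hp.one_lt
    rw [sq] at h
    have h2 : p = p * p := Nat.eq_of_mul_eq_mul_right (Nat.pos_of_ne_zero hm) h
    nlinarith)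
  obtain ⟨c, hc⟩ := hp.odd_of_ne_two hp2
  refine hj (1 + (p * m : ℕ) * ((c + 1) * j)) ?_
  have h0 : ((p ^ 2 * m : ℕ) : ZMod (p ^ 2 * m)) = 0 := ZMod.natCast_self _
  have hpc : (p : ZMod (p ^ 2 * m)) = 2 * c + 1 := by rw [hc]; push_cast; rfl
  push_cast at h0 ⊢
  linear_combination (j + m * ((c + 1) * j) ^ 2) * h0 - (p * m * j : ZMod (p ^ 2 * m)) * hpc

theorem DirichletCharacter.IsPrimitive.not_sixteen_dvd {N : ℕ} [NeZero N]
    {χ : DirichletCharacter ℂ N} (hχ : χ.IsPrimitive) (hquad : χ.IsQuadratic) : ¬ 16 ∣ N := by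
  rintro ⟨m, rfl⟩
  obtain ⟨j, hj⟩ := hχ.exists_forall_sq_ne hquad (d := 8 * m) ⟨2, by ring⟩ (by
    have := NeZero.ne (16 * m)
    omega)
  refine hj (1 + 4 * m * j) ?_
  have h0 : ((16 * m : ℕ) : ZMod (16 * m)) = 0 := ZMod.natCast_self _
  push_cast at h0 ⊢
  linear_combination (m * j ^ 2 : ZMod (16 * m)) * h0

theorem MulChar.eq_quadraticChar {F : Type*} [Field F] [Fintype F] [DecidableEq F]
    {χ : MulChar F ℂ} (hχ : χ ≠ 1) (hquad : χ.IsQuadratic) :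
    χ = (quadraticChar F).ringHomComp (Int.castRingHom ℂ) := by
  obtain ⟨u, hu⟩ := MulChar.ne_one_iff.mp hχ
  have hsq : ∀ a : F, a ≠ 0 → IsSquare a → χ a = 1 := by
    rintro _ ha ⟨b, rfl⟩
    rw [map_mul, ← sq]
    exact hquad.apply_sq_eq_one (isUnit_iff_ne_zero.mpr (by simpa using ha))
  have hu' : χ u = -1 := by
    rcases hquad u with h | h | h
    · exact absurd (u.isUnit.map χ) (by simp [h])
    · exact absurd h hu
    · exact h
  have hun : quadraticChar F (u : F) = -1 := by
    rw [quadraticChar_neg_one_iff_not_isSquare]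
    exact fun h => hu (hsq u u.ne_zero h)
  ext a
  rw [MulChar.ringHomComp_apply]
  rcases quadraticChar_dichotomy a.ne_zero with h | h
  · rw [h, hsq a a.ne_zero ((quadraticChar_one_iff_isSquare a.ne_zero).mp h)]; simp
  · rw [h]
    have h1 : quadraticChar F (u * a : F) = 1 := by rw [map_mul, hun, h]; norm_num
    have h2 := hsq _ (mul_ne_zero u.ne_zero a.ne_zero)
      ((quadraticChar_one_iff_isSquare (mul_ne_zero u.ne_zero a.ne_zero)).mp h1)
    rw [map_mul, hu'] at h2
    rw [eq_intCast]
    push_cast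
    linear_combination -h2

/-- `χ` behaves like the Kronecker symbol of discriminant `s * N`, where `s = χ (-1)`: its Gauss sum
has the classical sign and its values at odd primes are Legendre symbols. -/
def IsKroneckerLike {N : ℕ} [NeZero N] (χ : DirichletCharacter ℂ N) : Prop :=
  ∃ s : ℤ, χ (-1) = s ∧
    (s = 1 ∧ gaussSum χ ZMod.stdAddChar = √N ∨
      s = -1 ∧ gaussSum χ ZMod.stdAddChar = Complex.I * √N) ∧
    ∀ l : ℕ, [Fact l.Prime] → l ≠ 2 → ¬ l ∣ N → χ l = (legendreSym l (s * N) : ℂ)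

theorem legendreSym_eq_of_odd_prime {p l h : ℕ} [Fact p.Prime] [Fact l.Prime] (hp : p = 2 * h + 1)
    (hl : l ≠ 2) : legendreSym p l = legendreSym l ((-1) ^ h * p) := by
  have hl2 : l % 2 = 1 := (Fact.out : l.Prime).eq_two_or_odd.resolve_left hl
  rcases eq_or_ne p l with rfl | hne
  · have h0 : legendreSym p p = 0 := by
      rw [legendreSym.eq_zero_iff]; simp
    rw [legendreSym.mul, h0, mul_zero]
  rw [legendreSym.mul, legendreSym.quadratic_reciprocity' hl (by omega)]
  congr 1
  rw [show p / 2 = h by omega, pow_mul,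
    ← ZMod.χ₄_eq_neg_one_pow hl2, ← legendreSym.at_neg_one hl]
  exact (map_pow (legendreSym.hom l) (-1) h).symm

theorem IsKroneckerLike.of_split {p m h : ℕ} [Fact p.Prime] [NeZero m] (hp : p = 2 * h + 1)
    (hpm : p.Coprime m) {χ : DirichletCharacter ℂ (p * m)}
    (hleft : χ.splitLeft (ZMod.chineseRemainder hpm) =
      (quadraticChar (ZMod p)).ringHomComp (Int.castRingHom ℂ))
    (hright : IsKroneckerLike (N := m) (χ.splitRight (ZMod.chineseRemainder hpm))) :
    IsKroneckerLike χ := by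
  have hprime : p.Prime := Fact.out
  have hp2 : p ≠ 2 := by omega
  have hchar : ringChar (ZMod p) ≠ 2 := by rwa [ZMod.ringChar_zmod_n]
  obtain ⟨s, hs, hsG, hsl⟩ := hright
  have hval : ∀ j : ℤ, χ j = (legendreSym p j : ℂ) * χ.splitRight (ZMod.chineseRemainder hpm) j := by
    intro j
    have h1 : (ZMod.chineseRemainder hpm).symm ((j : ZMod p), (j : ZMod m)) = j := by
      rw [RingEquiv.symm_apply_eq, map_intCast]; rfl
    rw [← h1, ← MulChar.splitLeft_mul_splitRight, hleft, MulChar.ringHomComp_apply]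
    rfl
  have hneg : legendreSym p (-1) = (-1) ^ h := by
    rw [legendreSym.at_neg_one hp2, ZMod.χ₄_eq_neg_one_pow (by omega)]
    congr 1; omega
  refine ⟨(-1) ^ h * s, ?_, ?_, ?_⟩
  · have := hval (-1)
    rw [hneg] at this
    push_cast at this
    rw [this, hs]
    push_cast
    rfl
  · have hleg : legendreSym p m * legendreSym p m = 1 := by
      rw [← sq, legendreSym.sq_one]
      rw [Int.cast_natCast, Ne, ZMod.natCast_eq_zero_iff]
      exact (Nat.Prime.coprime_iff_not_dvd hprime).mp hpm
    have hG := gaussSum_eq_split hpm χ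
    rw [hsl p hp2 ((Nat.Prime.coprime_iff_not_dvd hprime).mp hpm), hleft, gaussSum_quadraticChar hp,
      MulChar.ringHomComp_apply] at hG
    have hq : (Int.castRingHom ℂ) (quadraticChar (ZMod p) (m : ZMod p)) = (legendreSym p m : ℂ) := by
      simp [legendreSym]
    have hsgn : (legendreSym p m : ℂ) * (legendreSym p (s * m) : ℂ) = (legendreSym p s : ℂ) := by
      rw [legendreSym.mul]
      exact_mod_cast (by linear_combination (legendreSym p s) * hleg :
        legendreSym p m * (legendreSym p s * legendreSym p m) = legendreSym p s)
    rw [hq, hsgn] at hG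
    have hIsq : ∀ k : ℕ, Complex.I ^ ((2 * k) ^ 2) = 1 ∧ Complex.I ^ ((2 * k + 1) ^ 2) = Complex.I := by
      intro k
      constructor
      · rw [show (2 * k) ^ 2 = 4 * k ^ 2 by ring, pow_mul, Complex.I_pow_four, one_pow]
      · rw [show (2 * k + 1) ^ 2 = 4 * (k ^ 2 + k) + 1 by ring, pow_succ, pow_mul,
          Complex.I_pow_four, one_pow, one_mul]
    rw [Nat.cast_mul, Real.sqrt_mul (Nat.cast_nonneg p), Complex.ofReal_mul]
    rcases Nat.even_or_odd' h with ⟨k, hk | hk⟩ <;> rcases hsG with ⟨rfl, hG2⟩ | ⟨rfl, hG2⟩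
    · left
      refine ⟨by simp [hk], ?_⟩
      rw [hG, hG2, legendreSym.at_one, hk, (hIsq k).1]
      push_cast; ring
    · right
      refine ⟨by simp [hk], ?_⟩
      rw [hG, hG2, hneg, hk, (hIsq k).1]
      simp
      ring
    · right
      refine ⟨by simp [hk, pow_succ], ?_⟩
      rw [hG, hG2, legendreSym.at_one, hk, (hIsq k).2]
      push_cast; ring
    · left
      refine ⟨by simp [hk, pow_succ], ?_⟩
      rw [hG, hG2, hneg, hk, (hIsq k).2, pow_succ, pow_mul]
      simp
      linear_combination (-(√p : ℂ) * √m) * Complex.I_sq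
  · intro l _ hl hlN
    have h1 := hval l
    rw [Int.cast_natCast, Int.cast_natCast, hsl l hl fun h => hlN (h.mul_left p),
      legendreSym_eq_of_odd_prime hp hl] at h1
    rw [h1, ← Int.cast_mul, ← legendreSym.mul]
    congr 2
    push_cast
    ring

theorem IsKroneckerLike.of_level_one (χ : DirichletCharacter ℂ 1) : IsKroneckerLike χ := by
  rw [χ.level_one]
  refine ⟨1, ?_, Or.inl ⟨rfl, ?_⟩, fun l _ _ _ => ?_⟩
  · rw [Subsingleton.elim (-1 : ZMod 1) 1]
    simp
  · rw [gaussSum, Fintype.sum_subsingleton _ (1 : ZMod 1), map_one,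
      Subsingleton.elim 1 (0 : ZMod 1), AddChar.map_zero_eq_one]
    simp
  · rw [Subsingleton.elim (l : ZMod 1) 1]
    simp

theorem intCast_two_ne_zero_of_prime {l : ℕ} [hl : Fact l.Prime] (hl2 : l ≠ 2) :
    ((2 : ℤ) : ZMod l) ≠ 0 := by
  rw [show (2 : ℤ) = (2 : ℕ) from rfl, Int.cast_natCast, Ne, ZMod.natCast_eq_zero_iff]
  exact fun h => hl2 ((Nat.prime_dvd_prime_iff_eq hl.out Nat.prime_two).mp h)

theorem ZMod.stdAddChar_natCast_eq_pow {N : ℕ} [NeZero N] (k : ℕ) :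
    (ZMod.stdAddChar (k : ZMod N) : ℂ) = ZMod.stdAddChar (1 : ZMod N) ^ k := by
  rw [← AddChar.map_nsmul_eq_pow, nsmul_one]

theorem IsKroneckerLike.of_level_four {χ : DirichletCharacter ℂ 4} (hχ : χ.IsPrimitive)
    (hquad : χ.IsQuadratic) : IsKroneckerLike χ := by
  have h3 : χ 3 = -1 := by
    obtain ⟨u, -, hu⟩ := hχ.exists_unit (one_dvd 4) (by norm_num)
    rcases hquad u with h | h | h
    · exact absurd (u.isUnit.map χ) (by simp [h])
    · exact absurd h hu
    · have : ∀ u : (ZMod 4)ˣ, (u : ZMod 4) = 1 ∨ (u : ZMod 4) = 3 := by decide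
      rcases this u with h' | h'
      · simp [h'] at hu
      · rwa [h'] at h
  have h0 : χ 0 = 0 := χ.map_nonunit (by decide)
  have h2 : χ 2 = 0 := χ.map_nonunit (by decide)
  have hneg : χ (-1) = -1 := h3
  refine ⟨-1, by simp [hneg], Or.inr ⟨rfl, ?_⟩, fun l _ hl _ => ?_⟩
  · have h1 : (ZMod.stdAddChar (1 : ZMod 4) : ℂ) = Complex.I := by
      have := ZMod.stdAddChar_coe (N := 4) 1
      rw [Int.cast_one] at this
      rw [this]
      convert Complex.exp_pi_div_two_mul_I using 2
      push_cast; ring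
    have h3' : (ZMod.stdAddChar (3 : ZMod 4) : ℂ) = -Complex.I := by
      rw [← Complex.I_pow_three, ← h1]
      exact ZMod.stdAddChar_natCast_eq_pow 3
    have : √((4 : ℕ) : ℝ) = 2 := by
      rw [show ((4 : ℕ) : ℝ) = 2 ^ 2 by norm_num, Real.sqrt_sq (by norm_num)]
    rw [this, gaussSum, show (univ : Finset (ZMod 4)) = {0, 1, 2, 3} by decide]
    rw [sum_insert (by decide), sum_insert (by decide), sum_insert (by decide), sum_singleton,
      h0, h2, h3, h1, h3', map_one]
    push_cast; ring
  · have hl2 : l % 2 = 1 := (Fact.out : l.Prime).eq_two_or_odd.resolve_left hl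
    have hleg : legendreSym l (-1 * (4 : ℕ)) = ZMod.χ₄ l := by
      rw [legendreSym.mul, legendreSym.at_neg_one hl, show ((4 : ℕ) : ℤ) = 2 ^ 2 by norm_num,
        legendreSym.sq_one' l (intCast_two_ne_zero_of_prime hl), mul_one]
    rw [hleg]
    have : (l : ZMod 4) = 1 ∨ (l : ZMod 4) = 3 := by
      rw [← ZMod.natCast_mod]
      have : l % 4 = 1 ∨ l % 4 = 3 := by omega
      rcases this with h | h <;> simp [h]
    rcases this with h | h <;> rw [h]
    · simp
    · rw [h3, show ZMod.χ₄ 3 = -1 by decide]; simp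

theorem IsKroneckerLike.of_level_eight {χ : DirichletCharacter ℂ 8} (hχ : χ.IsPrimitive)
    (hquad : χ.IsQuadratic) : IsKroneckerLike χ := by
  have h5 : χ 5 = -1 := by
    obtain ⟨u, hu4, hu⟩ := hχ.exists_unit (show 4 ∣ 8 by norm_num) (by norm_num)
    rcases hquad u with h | h | h
    · exact absurd (u.isUnit.map χ) (by simp [h])
    · exact absurd h hu
    · have : ∀ u : ZMod 8, ZMod.castHom (show 4 ∣ 8 by norm_num) (ZMod 4) u = 1 → u = 1 ∨ u = 5 := by
        decide
      rcases this u hu4 with h' | h'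
      · simp [h'] at hu
      · rwa [h'] at h
  have h7 : χ 7 = - χ 3 := by
    rw [show (7 : ZMod 8) = 3 * 5 by decide, map_mul, h5, mul_neg_one]
  have h3 : χ 3 = 1 ∨ χ 3 = -1 := (hquad 3).resolve_left fun h =>
    absurd ((show IsUnit (3 : ZMod 8) by decide).map χ) (by simp [h])
  have h0 : χ 0 = 0 := χ.map_nonunit (by decide)
  have h2 : χ 2 = 0 := χ.map_nonunit (by decide)
  have h4 : χ 4 = 0 := χ.map_nonunit (by decide)
  have h6 : χ 6 = 0 := χ.map_nonunit (by decide)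
  have hneg : χ (-1) = -χ 3 := h7
  have hsqrt : √((8 : ℕ) : ℝ) = 2 * √2 := by
    rw [show ((8 : ℕ) : ℝ) = 2 ^ 2 * 2 by norm_num, Real.sqrt_mul (by norm_num),
      Real.sqrt_sq (by norm_num)]
  set z : ℂ := ZMod.stdAddChar (1 : ZMod 8) with hz
  have hz' : z = √2 / 2 + √2 / 2 * Complex.I := by
    have := ZMod.stdAddChar_coe (N := 8) 1
    rw [Int.cast_one] at this
    rw [hz, this, show (2 * Real.pi * Complex.I * (1 : ℤ) / (8 : ℕ) : ℂ) =
      (Real.pi / 4 : ℝ) * Complex.I by push_cast; ring, Complex.exp_mul_I, ← Complex.ofReal_cos,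
      ← Complex.ofReal_sin, Real.cos_pi_div_four, Real.sin_pi_div_four]
    push_cast; ring
  have hsq : (√2 : ℂ) ^ 2 = 2 := by
    rw [← Complex.ofReal_pow, Real.sq_sqrt (by norm_num)]; simp
  have hz2 : z ^ 2 = Complex.I := by
    rw [hz']; linear_combination (1 / 4 + Complex.I / 2 + Complex.I ^ 2 / 4) * hsq +
      1 / 2 * Complex.I_sq
  have hG : gaussSum χ ZMod.stdAddChar = 2 * z * (1 + χ 3 * Complex.I) := by
    have hzpow (k : ℕ) : (ZMod.stdAddChar (k : ZMod 8) : ℂ) = z ^ k :=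
      ZMod.stdAddChar_natCast_eq_pow k
    have e3 := hzpow 3
    have e5 := hzpow 5
    have e7 := hzpow 7
    push_cast at e3 e5 e7
    rw [gaussSum, show (univ : Finset (ZMod 8)) = {0, 1, 2, 3, 4, 5, 6, 7} by decide]
    rw [sum_insert (by decide), sum_insert (by decide), sum_insert (by decide),
      sum_insert (by decide), sum_insert (by decide), sum_insert (by decide),
      sum_insert (by decide), sum_singleton, h0, h2, h4, h5, h6, h7, map_one, ← hz, e3, e5, e7,
      show z ^ 3 = z ^ 2 * z by ring, show z ^ 5 = (z ^ 2) ^ 2 * z by ring,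
      show z ^ 7 = (z ^ 2) ^ 3 * z by ring, hz2, Complex.I_sq, Complex.I_pow_three]
    ring
  have hχl {l : ℕ} (hl2 : l % 2 = 1) : (l : ZMod 8) = 1 ∨ (l : ZMod 8) = 3 ∨ (l : ZMod 8) = 5 ∨
      (l : ZMod 8) = 7 := by
    rw [← ZMod.natCast_mod]
    have : l % 8 = 1 ∨ l % 8 = 3 ∨ l % 8 = 5 ∨ l % 8 = 7 := by omega
    rcases this with h | h | h | h <;> simp [h]
  have hodd (l : ℕ) [Fact l.Prime] (hl : l ≠ 2) : l % 2 = 1 :=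
    (Fact.out : l.Prime).eq_two_or_odd.resolve_left hl
  have hleg (l : ℕ) [Fact l.Prime] (hl : l ≠ 2) (s : ℤ) :
      legendreSym l (s * (8 : ℕ)) = legendreSym l (s * 2) := by
    rw [show s * ((8 : ℕ) : ℤ) = s * 2 * 2 ^ 2 by push_cast; ring, legendreSym.mul,
      legendreSym.sq_one' l (intCast_two_ne_zero_of_prime hl), mul_one]
  rcases h3 with h3 | h3
  · refine ⟨-1, by simp [hneg, h3], Or.inr ⟨rfl, ?_⟩, fun l _ hl _ => ?_⟩
    · rw [hG, h3, hz', hsqrt]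
      push_cast
      linear_combination (√2 : ℂ) * Complex.I_sq
    · rw [hleg l hl, neg_one_mul, legendreSym.at_neg_two hl]
      rcases hχl (hodd l hl) with h | h | h | h <;> rw [h]
      · simp
      · rw [h3, show ZMod.χ₈' 3 = 1 by decide]; simp
      · rw [h5, show ZMod.χ₈' 5 = -1 by decide]; simp
      · rw [h7, h3, show ZMod.χ₈' 7 = -1 by decide]; simp
  · refine ⟨1, by simp [hneg, h3], Or.inl ⟨rfl, ?_⟩, fun l _ hl _ => ?_⟩
    · rw [hG, h3, hz', hsqrt]
      push_cast
      linear_combination -(√2 : ℂ) * Complex.I_sq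
    · rw [hleg l hl, one_mul, legendreSym.at_two hl]
      rcases hχl (hodd l hl) with h | h | h | h <;> rw [h]
      · simp
      · rw [h3, show ZMod.χ₈ 3 = -1 by decide]; simp
      · rw [h5, show ZMod.χ₈ 5 = -1 by decide]; simp
      · rw [h7, h3, show ZMod.χ₈ 7 = 1 by decide]; simp

theorem ZMod.chineseRemainder_fst {p m : ℕ} (hpm : p.Coprime m) (x : ZMod (p * m)) :
    (ZMod.chineseRemainder hpm x).1 = ZMod.castHom (Dvd.intro m rfl : p ∣ p * m) (ZMod p) x :=
  RingHom.congr_fun (RingHom.ext_zmod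
    ((RingHom.fst (ZMod p) (ZMod m)).comp (ZMod.chineseRemainder hpm).toRingHom) _) x

theorem ZMod.chineseRemainder_snd {p m : ℕ} (hpm : p.Coprime m) (x : ZMod (p * m)) :
    (ZMod.chineseRemainder hpm x).2 = ZMod.castHom (Dvd.intro_left p rfl : m ∣ p * m) (ZMod m) x :=
  RingHom.congr_fun (RingHom.ext_zmod
    ((RingHom.snd (ZMod p) (ZMod m)).comp (ZMod.chineseRemainder hpm).toRingHom) _) x

theorem DirichletCharacter.IsPrimitive.splitLeft_ne_one {p m : ℕ} [NeZero p] [NeZero m] (hp : 1 < p)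
    (hpm : p.Coprime m) {χ : DirichletCharacter ℂ (p * m)} (hχ : χ.IsPrimitive) :
    MulChar.splitLeft (ZMod.chineseRemainder hpm) χ ≠ 1 := by
  intro H
  have hm : 0 < m := NeZero.pos m
  obtain ⟨u, hu, hχu⟩ := hχ.exists_unit (Dvd.intro_left p rfl : m ∣ p * m) (by nlinarith)
  refine hχu ?_
  have hu2 : (ZMod.chineseRemainder hpm u).2 = 1 := (ZMod.chineseRemainder_snd hpm u).trans hu
  rw [← (ZMod.chineseRemainder hpm).symm_apply_apply (u : ZMod (p * m)),
    ← Prod.mk.eta (p := ZMod.chineseRemainder hpm u), ← MulChar.splitLeft_mul_splitRight, H, hu2,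
    map_one, mul_one]
  exact MulChar.one_apply ((u.isUnit.map (ZMod.chineseRemainder hpm)).map (RingHom.fst _ _))

theorem DirichletCharacter.IsPrimitive.splitRight {p m : ℕ} [NeZero p] [NeZero m]
    (hpm : p.Coprime m) {χ : DirichletCharacter ℂ (p * m)} (hχ : χ.IsPrimitive) :
    DirichletCharacter.IsPrimitive (n := m)
      (MulChar.splitRight (ZMod.chineseRemainder hpm) χ) := by
  refine DirichletCharacter.isPrimitive_of_exists_unit fun d hd hdm => ?_
  obtain ⟨u, hu, hχu⟩ := hχ.exists_unit (Nat.mul_dvd_mul_left p hd)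
    (by simpa [NeZero.ne p] using hdm)
  have h1 : (ZMod.chineseRemainder hpm u).1 = 1 := by
    have := congrArg (ZMod.castHom (Dvd.intro d rfl : p ∣ p * d) (ZMod p)) hu
    rw [map_one, ← RingHom.comp_apply, ZMod.castHom_comp] at this
    exact (ZMod.chineseRemainder_fst hpm u).trans this
  have h2 : ZMod.castHom hd (ZMod d) (ZMod.chineseRemainder hpm u).2 = 1 := by
    have := congrArg (ZMod.castHom (Dvd.intro_left p rfl : d ∣ p * d) (ZMod d)) hu
    rw [map_one, ← RingHom.comp_apply, ZMod.castHom_comp] at this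
    rw [← this, ZMod.chineseRemainder_snd, ← RingHom.comp_apply, ZMod.castHom_comp]
  have hunit := (u.isUnit.map (ZMod.chineseRemainder hpm)).map (RingHom.snd _ _)
  refine ⟨hunit.unit, h2, fun H => hχu ?_⟩
  rw [← (ZMod.chineseRemainder hpm).symm_apply_apply (u : ZMod (p * m)),
    ← Prod.mk.eta (p := ZMod.chineseRemainder hpm u), ← MulChar.splitLeft_mul_splitRight, h1,
    map_one, one_mul]
  exact H

theorem DirichletCharacter.IsPrimitive.isKroneckerLike {N : ℕ} [inst : NeZero N]
    {χ : DirichletCharacter ℂ N} (hχ : χ.IsPrimitive) (hquad : χ.IsQuadratic) :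
    IsKroneckerLike χ := by
  induction N using Nat.strong_induction_on generalizing inst with
  | _ N IH =>
  by_cases hodd : ∃ p, p.Prime ∧ p ≠ 2 ∧ p ∣ N
  · obtain ⟨p, hp, hp2, m, rfl⟩ := hodd
    have : Fact p.Prime := ⟨hp⟩
    have hm0 : m ≠ 0 := by
      rintro rfl
      exact NeZero.ne (p * 0) (mul_zero p)
    have : NeZero m := ⟨hm0⟩
    have hpm : p.Coprime m := by
      rw [hp.coprime_iff_not_dvd]
      intro h
      exact hχ.not_sq_dvd hquad hp hp2 (by rw [sq]; exact Nat.mul_dvd_mul_left p h)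
    obtain ⟨h, hh⟩ := hp.odd_of_ne_two hp2
    refine IsKroneckerLike.of_split hh hpm
      (MulChar.eq_quadraticChar (hχ.splitLeft_ne_one hp.one_lt hpm) fun a => hquad _)
      (IH m ?_ (hχ.splitRight hpm) fun a => hquad _)
    have := hp.one_lt
    have := Nat.pos_of_ne_zero hm0
    nlinarith
  · push Not at hodd
    have hN : N = 2 ^ N.primeFactorsList.length :=
      Nat.eq_prime_pow_of_unique_prime_dvd (NeZero.ne N) fun {d} hd hdN => by
        by_contra h
        exact hodd d hd h hdN
    generalize N.primeFactorsList.length = k at hN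
    have hk : k < 4 := by
      by_contra! h
      exact hχ.not_sixteen_dvd hquad (hN ▸ pow_dvd_pow 2 h)
    interval_cases k
    · subst hN
      exact IsKroneckerLike.of_level_one χ
    · subst hN
      obtain ⟨u, -, hu⟩ := hχ.exists_unit (one_dvd _) (by norm_num)
      exact absurd (by rw [Subsingleton.elim (α := (ZMod 2)ˣ) u 1]; simp) hu
    · subst hN
      exact IsKroneckerLike.of_level_four hχ hquad
    · subst hN
      exact IsKroneckerLike.of_level_eight hχ hquad

theorem MulChar.isQuadratic_of_im_eq_zero {R : Type*} [CommRing R] [Finite Rˣ] {χ : MulChar R ℂ}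
    (h : ∀ x, (χ x).im = 0) : χ.IsQuadratic := by
  intro a
  by_cases ha : IsUnit a
  · right
    have hfin : IsOfFinOrder ha.unit := isOfFinOrder_of_finite _
    obtain ⟨k, hk, hk1⟩ := hfin.exists_pow_eq_one
    have hpow : χ a ^ k = 1 := by
      have := congrArg (fun u : Rˣ => χ u) hk1
      simpa using this
    have hnorm : ‖χ a‖ = 1 := Complex.norm_eq_one_of_pow_eq_one hpow hk.ne'
    have hre : χ a = ((χ a).re : ℂ) := Complex.ext rfl (by simp [h a])
    rw [hre, Complex.norm_real, Real.norm_eq_abs] at hnorm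
    rcases eq_or_eq_neg_of_abs_eq hnorm with h' | h'
    · left; rw [hre, h']; simp
    · right; rw [hre, h']; simp
  · exact Or.inl (χ.map_nonunit ha)

theorem DirichletCharacter.IsPrimitive.gaussSum_eq_sqrt {N : ℕ} [NeZero N]
    {χ : DirichletCharacter ℂ N} (hχ : χ.IsPrimitive) (hquad : χ.IsQuadratic) (heven : χ (-1) = 1) :
    gaussSum χ ZMod.stdAddChar = √N := by
  obtain ⟨s, hs, h | ⟨rfl, -⟩, -⟩ := hχ.isKroneckerLike hquad
  · exact h.2
  · rw [heven] at hs
    norm_num at hs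

/-- The heat kernel weight of the frequency `j` on the cycle `ℤ/mℤ` at time `t`. -/
noncomputable def cycleHeat (m : ℕ) (t : ℝ) (j : ℕ) : ℝ :=
  Real.exp (-(4 * t * Real.sin (Real.pi * j / m) ^ 2))

theorem cycleHeat_pos (m : ℕ) (t : ℝ) (j : ℕ) : 0 < cycleHeat m t j := Real.exp_pos _

theorem cycleHeat_sub {m j : ℕ} (t : ℝ) (hm : 0 < m) (hj : j ≤ m) :
    cycleHeat m t (m - j) = cycleHeat m t j := by
  have : (m : ℝ) ≠ 0 := by positivity
  rw [cycleHeat, cycleHeat, Nat.cast_sub hj,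
    show Real.pi * ((m : ℝ) - j) / m = Real.pi - Real.pi * j / m by field_simp, Real.sin_pi_sub]

theorem pi_sq_lt_sixteen : Real.pi ^ 2 < 16 := by
  nlinarith [Real.pi_pos, Real.pi_lt_four]

theorem cycleHeat_le_of_two_mul_le {m j : ℕ} {t : ℝ} (hj : 2 ≤ j) (hjm : 2 * j ≤ m)
    (ht : m ^ 2 * Real.log 2 / (4 * (16 - Real.pi ^ 2)) < t) :
    cycleHeat m t j ≤ (1 / 2) ^ (j - 1) * cycleHeat m t 1 := by
  have hm : (0 : ℝ) < m := by exact_mod_cast (by omega : 0 < m)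
  have hj' : (2 : ℝ) ≤ j := by exact_mod_cast hj
  have hjm' : 2 * (j : ℝ) ≤ m := by exact_mod_cast hjm
  have hpi := Real.pi_pos
  have h16 : 0 < 16 - Real.pi ^ 2 := sub_pos.mpr pi_sq_lt_sixteen
  have hlog : 0 < Real.log 2 := Real.log_pos one_lt_two
  have h1 : 2 * j / m ≤ Real.sin (Real.pi * j / m) := by
    have := Real.mul_le_sin (x := Real.pi * j / m) (by positivity)
      (by rw [div_le_div_iff₀ hm two_pos]; nlinarith)
    calc (2 * j / m : ℝ) = 2 / Real.pi * (Real.pi * j / m) := by field_simp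
      _ ≤ _ := this
  have h2 : Real.sin (Real.pi * (1 : ℕ) / m) ≤ Real.pi / m := by
    rw [Nat.cast_one, mul_one]; exact Real.sin_le (by positivity)
  have h3 : 0 ≤ Real.sin (Real.pi * (1 : ℕ) / m) := by
    apply Real.sin_nonneg_of_nonneg_of_le_pi (by positivity)
    rw [Nat.cast_one, mul_one]
    exact div_le_self hpi.le (by linarith)
  have h4 : (4 * j ^ 2 - Real.pi ^ 2) / m ^ 2 ≤
      Real.sin (Real.pi * j / m) ^ 2 - Real.sin (Real.pi * (1 : ℕ) / m) ^ 2 := by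
    have h5 := pow_le_pow_left₀ (by positivity) h1 2
    have h6 := pow_le_pow_left₀ h3 h2 2
    calc ((4 * j ^ 2 - Real.pi ^ 2) / m ^ 2 : ℝ) = (2 * j / m) ^ 2 - (Real.pi / m) ^ 2 := by
          field_simp; ring
      _ ≤ _ := by linarith
  have h7 : (16 - Real.pi ^ 2) * (j - 1) ≤ 4 * j ^ 2 - Real.pi ^ 2 := by
    nlinarith [mul_nonneg (sq_nonneg Real.pi) (sub_nonneg.mpr hj'), sq_nonneg ((j : ℝ) - 2)]
  have ht0 : 0 < t := lt_of_le_of_lt (by positivity) ht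
  have h8 : m ^ 2 * Real.log 2 < t * (4 * (16 - Real.pi ^ 2)) := by
    rwa [div_lt_iff₀ (by positivity)] at ht
  have h9 : (j - 1) * Real.log 2 ≤ 4 * t * ((4 * j ^ 2 - Real.pi ^ 2) / m ^ 2) := by
    rw [mul_div_assoc', le_div_iff₀ (by positivity)]
    calc ((j - 1) * Real.log 2 * m ^ 2 : ℝ) = (j - 1) * (m ^ 2 * Real.log 2) := by ring
      _ ≤ (j - 1) * (t * (4 * (16 - Real.pi ^ 2))) :=
        mul_le_mul_of_nonneg_left h8.le (by linarith)
      _ = 4 * t * ((16 - Real.pi ^ 2) * (j - 1)) := by ring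
      _ ≤ _ := mul_le_mul_of_nonneg_left h7 (by positivity)
  have h10 : ((1 / 2 : ℝ)) ^ (j - 1) = Real.exp (-((j - 1) * Real.log 2)) := by
    rw [one_div, inv_pow, Real.exp_neg, ← Nat.cast_pred (by omega), mul_comm, Real.exp_mul,
      Real.exp_log two_pos, Real.rpow_natCast]
  rw [h10, cycleHeat, cycleHeat, ← Real.exp_add, Real.exp_le_exp]
  nlinarith [mul_le_mul_of_nonneg_left h4 (by positivity : 0 ≤ 4 * t)]

theorem cycleHeat_le {m j : ℕ} {t : ℝ} (hj : 2 ≤ j) (hjm : j + 2 ≤ m)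
    (ht : m ^ 2 * Real.log 2 / (4 * (16 - Real.pi ^ 2)) < t) :
    cycleHeat m t j ≤ ((1 / 2) ^ (j - 1) + (1 / 2) ^ (m - j - 1)) * cycleHeat m t 1 := by
  have h1 := (cycleHeat_pos m t 1).le
  rw [add_mul]
  rcases le_total (2 * j) m with h | h
  · exact (cycleHeat_le_of_two_mul_le hj h ht).trans (le_add_of_nonneg_right (by positivity))
  · rw [← cycleHeat_sub t (by omega) (by omega : j ≤ m)]
    exact (cycleHeat_le_of_two_mul_le (by omega) (by omega) ht).trans
      (le_add_of_nonneg_left (by positivity))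

theorem sum_Ico_two_half_pow_le (k : ℕ) : ∑ j ∈ Ico 2 k, (1 / 2 : ℝ) ^ (j - 1) ≤ 1 := by
  rw [sum_Ico_eq_sum_range]
  calc ∑ j ∈ range (k - 2), (1 / 2 : ℝ) ^ (2 + j - 1)
      = 1 / 2 * ∑ j ∈ range (k - 2), (1 / 2 : ℝ) ^ j := by
        rw [mul_sum]
        refine sum_congr rfl fun j _ => ?_
        rw [show 2 + j - 1 = j + 1 by omega, pow_succ']
    _ ≤ 1 / 2 * 2 := by gcongr; exact sum_geometric_two_le _
    _ = 1 := by norm_num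

theorem sum_mul_cycleHeat_nonneg_of_large {m : ℕ} (hm : 2 ≤ m) {t : ℝ} {f : ℕ → ℝ}
    (hf : ∀ j, |f j| ≤ 1) (hf1 : f 1 = 1) (hfm : f (m - 1) = 1)
    (ht : m ^ 2 * Real.log 2 / (4 * (16 - Real.pi ^ 2)) < t) :
    0 ≤ ∑ j ∈ Ico 1 m, f j * cycleHeat m t j := by
  have h1 := (cycleHeat_pos m t 1).le
  rcases hm.eq_or_lt with rfl | hm
  · simpa [hf1] using h1
  obtain ⟨k, rfl⟩ : ∃ k, m = k + 1 := ⟨m - 1, by omega⟩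
  have hlast := cycleHeat_sub t (by omega) (by omega : 1 ≤ k + 1)
  rw [Nat.add_sub_cancel] at hfm hlast
  rw [sum_Ico_succ_top (by omega), sum_eq_sum_Ico_succ_bot (by omega), hf1, hfm, hlast]
  have hmid : ∑ j ∈ Ico 2 k, -(f j * cycleHeat (k + 1) t j) ≤ 2 * cycleHeat (k + 1) t 1 :=
    calc ∑ j ∈ Ico 2 k, -(f j * cycleHeat (k + 1) t j)
        ≤ ∑ j ∈ Ico 2 k, ((1 / 2) ^ (j - 1) + (1 / 2) ^ (k + 1 - j - 1)) *
            cycleHeat (k + 1) t 1 := by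
          refine sum_le_sum fun j hj => ?_
          rw [mem_Ico] at hj
          refine le_trans ?_ (cycleHeat_le hj.1 (by omega) ht)
          nlinarith [neg_le_of_abs_le (hf j), cycleHeat_pos (k + 1) t j]
      _ ≤ (1 + 1) * cycleHeat (k + 1) t 1 := by
          rw [← sum_mul, sum_add_distrib]
          have hrefl : ∑ j ∈ Ico 2 k, (1 / 2 : ℝ) ^ (k + 1 - j - 1) =
              ∑ j ∈ Ico 2 k, (1 / 2 : ℝ) ^ (j - 1) := by
            have := sum_Ico_reflect (fun j => (1 / 2 : ℝ) ^ (j - 1)) 2 (by omega : k ≤ k + 1 + 1)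
            rwa [show k + 1 + 1 - k = 2 by omega, show k + 1 + 1 - 2 = k by omega] at this
          rw [hrefl]
          gcongr <;> exact sum_Ico_two_half_pow_le k
      _ = _ := by ring
  rw [sum_neg_distrib] at hmid
  norm_num
  linarith

/-- The modified Bessel function `I_k` of the first kind at the point `2 * t`. -/
noncomputable def besselI (t : ℝ) (k : ℕ) : ℝ :=
  ∑' j : ℕ, t ^ (2 * j + k) / (j.factorial * (j + k).factorial)

theorem summable_besselI (t : ℝ) (k : ℕ) :
    Summable fun j : ℕ => t ^ (2 * j + k) / (j.factorial * (j + k).factorial) := by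
  refine .of_norm_bounded (g := fun j : ℕ => |t| ^ k * ((t ^ 2) ^ j / j.factorial))
    ((Real.summable_pow_div_factorial (t ^ 2)).mul_left _) fun j => ?_
  rw [Real.norm_eq_abs, abs_div, abs_pow, abs_of_pos (by positivity :
    (0 : ℝ) < j.factorial * (j + k).factorial), ← sq_abs t, ← pow_mul, ← mul_div_assoc, ← pow_add,
    add_comm k]
  refine div_le_div_of_nonneg_left (by positivity) (by positivity) ?_
  exact le_mul_of_one_le_right (by positivity) (by exact_mod_cast (j + k).factorial_pos)

theorem besselI_nonneg {t : ℝ} (ht : 0 ≤ t) (k : ℕ) : 0 ≤ besselI t k :=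
  tsum_nonneg fun _ => by positivity

theorem besselI_succ_le {t : ℝ} (ht : 0 ≤ t) (k : ℕ) : besselI t (k + 1) ≤ besselI t k := by
  have hs := summable_besselI t k
  have h2 : ∀ j : ℕ, 2 * (t ^ (2 * j + (k + 1)) / (j.factorial * (j + (k + 1)).factorial)) ≤
      t ^ (2 * j + k) / (j.factorial * (j + k).factorial) +
      t ^ (2 * (j + 1) + k) / ((j + 1).factorial * (j + 1 + k).factorial) := by
    intro j
    rw [show j + (k + 1) = j + k + 1 by ring, show j + 1 + k = j + k + 1 by ring,
      Nat.factorial_succ (j + k), Nat.factorial_succ j]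
    push_cast
    have hj : (0 : ℝ) < j.factorial := by positivity
    have hjk : (0 : ℝ) < (j + k).factorial := by positivity
    rw [← sub_nonneg]
    have : t ^ (2 * j + k) / (j.factorial * (j + k).factorial) +
        t ^ (2 * (j + 1) + k) / ((j + 1) * j.factorial * ((j + k + 1) * (j + k).factorial)) -
        2 * (t ^ (2 * j + (k + 1)) / (j.factorial * ((j + k + 1) * (j + k).factorial))) =
        t ^ (2 * j + k) / (j.factorial * (j + k).factorial) *
          ((1 - t / (j + k + 1)) ^ 2 + (t / (j + k + 1)) ^ 2 * (k / (j + 1))) := by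
      field_simp
      ring
    rw [this]
    positivity
  have hle := (summable_besselI t (k + 1)).mul_left 2 |>.tsum_le_tsum h2
    (hs.add ((summable_nat_add_iff 1).mpr hs))
  rw [tsum_mul_left, hs.tsum_add ((summable_nat_add_iff 1).mpr hs)] at hle
  have h0 := hs.tsum_eq_zero_add
  have hpos : 0 ≤ t ^ (2 * 0 + k) / (Nat.factorial 0 * (0 + k).factorial) := by positivity
  simp only [besselI]
  linarith

theorem besselI_recurrence (t : ℝ) (k : ℕ) :
    (k + 1) * besselI t (k + 1) = t * (besselI t k - besselI t (k + 2)) := by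
  have h0 : HasSum (fun j : ℕ => t * (t ^ (2 * j + k) / (j.factorial * (j + k).factorial)) -
      (k + 1) * (t ^ (2 * j + (k + 1)) / (j.factorial * (j + (k + 1)).factorial)))
      (t * besselI t k - (k + 1) * besselI t (k + 1)) :=
    ((summable_besselI t k).hasSum.mul_left _).sub ((summable_besselI t (k + 1)).hasSum.mul_left _)
  rw [← hasSum_nat_add_iff' 1] at h0
  have h1 := h0.unique (((summable_besselI t (k + 2)).hasSum.mul_left t).congr_fun fun j => by
    rw [show j + 1 + k = j + k + 1 by ring, show j + 1 + (k + 1) = j + k + 1 + 1 by ring,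
      show j + (k + 2) = j + k + 1 + 1 by ring, Nat.factorial_succ (j + k + 1),
      Nat.factorial_succ j]
    push_cast
    field_simp
    ring)
  have h2 : t * (t ^ (2 * 0 + k) / (Nat.factorial 0 * (0 + k).factorial)) -
      (k + 1) * (t ^ (2 * 0 + (k + 1)) / (Nat.factorial 0 * (0 + (k + 1)).factorial)) = 0 := by
    rw [show 0 + (k + 1) = k + 1 by ring, Nat.factorial_succ k, zero_add]
    push_cast
    field_simp
    ring
  rw [sum_range_one, h2] at h1
  change _ = t * besselI t (k + 2) at h1
  linarith

theorem mul_besselI_le {t : ℝ} (ht : 0 ≤ t) (a n : ℕ) :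
    (n * a + n ^ 2 / 2) * besselI t (a + n) + t * (besselI t (a + n) + besselI t (a + n + 1)) ≤
      t * (besselI t a + besselI t (a + 1)) := by
  induction n with
  | zero => simp
  | succ n ih =>
    have h1 := besselI_recurrence t (a + n)
    have h2 := besselI_succ_le ht (a + n)
    have h3 := besselI_nonneg ht (a + n + 1)
    have h4 : (0 : ℝ) ≤ n * a + n ^ 2 / 2 := by positivity
    have h5 := mul_le_mul_of_nonneg_left h2 h4
    push_cast at h1 ⊢
    rw [← add_assoc, show a + n + 1 + 1 = a + n + 2 by ring]
    nlinarith

theorem sum_besselI_le {t : ℝ} (ht : 0 ≤ t) (n L : ℕ) :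
    3 / 2 * n ^ 2 * ∑ l ∈ Ico 2 (L + 2), besselI t (n * l) +
      t * (besselI t (n * (L + 1)) + besselI t (n * (L + 1) + 1)) ≤
      t * (besselI t n + besselI t (n + 1)) := by
  induction L with
  | zero => simp
  | succ L ih =>
    have h1 := mul_besselI_le ht (n * (L + 1)) n
    rw [show n * (L + 1) + n = n * (L + 1 + 1) by ring] at h1
    have h2 : 0 ≤ (n : ℝ) ^ 2 * L * besselI t (n * (L + 1 + 1)) := by
      have := besselI_nonneg ht (n * (L + 1 + 1))
      positivity
    rw [show L + 1 + 2 = L + 2 + 1 by ring, sum_Ico_succ_top (by omega : 2 ≤ L + 2)]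
    change _ * (_ + besselI t (n * (L + 1 + 1))) + _ ≤ _
    push_cast at h1
    linarith

theorem sum_besselI_le_besselI {t : ℝ} {n : ℕ} (hn : 1 ≤ n) (ht : 0 ≤ t)
    (htn : t < n ^ 2 / (2 * Real.log 2)) (L : ℕ) :
    ∑ l ∈ Ico 2 (L + 2), besselI t (n * l) ≤ besselI t n := by
  have h1 := sum_besselI_le ht n L
  have h2 := mul_nonneg ht (besselI_nonneg ht (n * (L + 1)))
  have h3 := mul_nonneg ht (besselI_nonneg ht (n * (L + 1) + 1))
  have h4 := mul_le_mul_of_nonneg_left (besselI_succ_le ht n) ht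
  have hlog := Real.log_two_gt_d9
  have hn' : (0 : ℝ) < n ^ 2 := by positivity
  have h5 : t ≤ 3 / 4 * n ^ 2 := by
    rw [lt_div_iff₀ (by linarith)] at htn
    nlinarith
  have h6 := mul_le_mul_of_nonneg_right h5 (besselI_nonneg ht n)
  have h7 : 3 / 2 * (n : ℝ) ^ 2 * ∑ l ∈ Ico 2 (L + 2), besselI t (n * l) ≤
    3 / 2 * n ^ 2 * besselI t n := by linarith
  exact le_of_mul_le_mul_left h7 (by positivity)

/-- Pairs of natural numbers, sorted by their difference. -/
def intProdNatEquiv : ℤ × ℕ ≃ ℕ × ℕ where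
  toFun x := (x.2 + x.1.toNat, x.2 + (-x.1).toNat)
  invFun y := (y.1 - y.2, min y.1 y.2)
  left_inv x := Prod.ext (by simp) (by simp; omega)
  right_inv y := Prod.ext (by simp; omega) (by simp; omega)

theorem hasSum_expSeries_mul_expSeries (v w : ℂ) :
    HasSum (fun x : ℕ × ℕ => v ^ x.1 / x.1.factorial * (w ^ x.2 / x.2.factorial))
      (Complex.exp v * Complex.exp w) := by
  have h1 (w : ℂ) : HasSum (fun a : ℕ => w ^ a / a.factorial) (Complex.exp w) := by
    rw [Complex.exp_eq_exp_ℂ]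
    exact NormedSpace.expSeries_div_hasSum_exp w
  have h2 (w : ℂ) : Summable fun a : ℕ => ‖w ^ a / a.factorial‖ :=
    NormedSpace.norm_expSeries_div_summable w
  have key : ∀ f g : ℕ → ℂ, HasSum f (Complex.exp v) → HasSum g (Complex.exp w) →
      (Summable fun a => ‖f a‖) → (Summable fun a => ‖g a‖) →
      HasSum (fun x : ℕ × ℕ => f x.1 * g x.2) (Complex.exp v * Complex.exp w) :=
    fun f g hf hg hf' hg' => hf.mul hg (summable_mul_of_summable_norm hf' hg')
  have := key (fun a => v ^ a / a.factorial) (fun a => w ^ a / a.factorial) (h1 v) (h1 w) (h2 v)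
    (h2 w)
  exact this

theorem hasSum_besselI_mul_zpow (t : ℝ) {z : ℂ} (hz : z ≠ 0) :
    HasSum (fun k : ℤ => (besselI t k.natAbs : ℂ) * z ^ k) (Complex.exp (t * (z + z⁻¹))) := by
  have h3 : HasSum (fun x : ℕ × ℕ =>
      (t * z : ℂ) ^ x.1 / x.1.factorial * ((t * z⁻¹) ^ x.2 / x.2.factorial))
      (Complex.exp (t * (z + z⁻¹))) := by
    rw [mul_add, Complex.exp_add]
    exact hasSum_expSeries_mul_expSeries (t * z) (t * z⁻¹)
  have h4 : HasSum (fun x : ℤ × ℕ => ((t ^ (2 * x.2 + x.1.natAbs) /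
      (x.2.factorial * (x.2 + x.1.natAbs).factorial) : ℝ) : ℂ) * z ^ x.1)
      (Complex.exp (t * (z + z⁻¹))) := by
    refine (intProdNatEquiv.hasSum_iff.mpr h3).congr_fun fun ⟨k, j⟩ => ?_
    have hz' : z ^ j * z⁻¹ ^ j = 1 := by rw [← mul_pow, mul_inv_cancel₀ hz, one_pow]
    obtain ⟨n, rfl | rfl⟩ := k.eq_nat_or_neg
    · simp only [Function.comp_apply, intProdNatEquiv, Equiv.coe_fn_mk, Int.natAbs_natCast,
        Int.toNat_natCast, Int.toNat_neg_natCast, add_zero, zpow_natCast, mul_pow]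
      push_cast
      rw [div_mul_div_comm, div_mul_eq_mul_div, mul_comm (Nat.factorial j : ℂ)]
      congr 1
      linear_combination (-(t : ℂ) ^ (2 * j + n) * z ^ n) * hz'
    · simp only [Function.comp_apply, intProdNatEquiv, Equiv.coe_fn_mk, Int.natAbs_neg,
        Int.natAbs_natCast, neg_neg,
        Int.toNat_natCast, Int.toNat_neg_natCast, add_zero, zpow_neg, zpow_natCast, mul_pow]
      push_cast
      rw [div_mul_div_comm, div_mul_eq_mul_div, ← inv_pow]
      congr 1
      linear_combination (-(t : ℂ) ^ (2 * j + n) * z⁻¹ ^ n) * hz'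
  exact h4.prod_fiberwise fun k =>
    (Complex.hasSum_ofReal.mpr (summable_besselI t k.natAbs).hasSum).mul_right (z ^ k)

theorem sum_range_mul_eq_sum_sum {M : Type*} [AddCommMonoid M] (f : ℕ → M) (q n : ℕ) :
    ∑ j ∈ range (q * n), f j = ∑ b ∈ range n, ∑ a ∈ range q, f (q * b + a) := by
  induction n with
  | zero => simp
  | succ n ih => rw [mul_add_one, sum_range_add, ih, sum_range_succ]

theorem geom_sum_exp_eq {n : ℕ} (hn : n ≠ 0) (k : ℤ) :
    ∑ b ∈ range n, Complex.exp (2 * Real.pi * Complex.I * k / n) ^ b =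
      if (n : ℤ) ∣ k then (n : ℂ) else 0 := by
  have hn' : (n : ℂ) ≠ 0 := Nat.cast_ne_zero.mpr hn
  split_ifs with h
  · obtain ⟨l, rfl⟩ := h
    have : Complex.exp (2 * Real.pi * Complex.I * ((n * l : ℤ) : ℂ) / n) = 1 := by
      rw [Complex.exp_eq_one_iff]
      exact ⟨l, by push_cast; field_simp⟩
    simp only [this, one_pow, sum_const, card_range, nsmul_eq_mul, mul_one]
  · have h1 : Complex.exp (2 * Real.pi * Complex.I * k / n) ≠ 1 := by
      rw [Ne, Complex.exp_eq_one_iff]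
      rintro ⟨l, hl⟩
      refine h ⟨l, ?_⟩
      have hpi : (Real.pi : ℂ) ≠ 0 := Complex.ofReal_ne_zero.mpr Real.pi_ne_zero
      field_simp at hl
      have : (k : ℂ) = n * l := by
        linear_combination hl
      exact_mod_cast this
    rw [geom_sum_eq h1, ← Complex.exp_nat_mul, div_eq_zero_iff, sub_eq_zero]
    left
    rw [Complex.exp_eq_one_iff]
    exact ⟨k, by field_simp⟩

/-- The Fourier coefficients of a real even primitive character inflated from level `q` to level
`q * n`. -/
theorem DirichletCharacter.IsPrimitive.sum_mul_exp_zpow {q n : ℕ} [NeZero q] (hn : n ≠ 0)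
    {χ : DirichletCharacter ℂ q} (hχ : χ.IsPrimitive) (hquad : χ.IsQuadratic) (heven : χ (-1) = 1)
    (k : ℤ) :
    ∑ j ∈ range (q * n), χ (j : ZMod q) *
        Complex.exp (2 * Real.pi * Complex.I * j / (q * n : ℕ)) ^ k =
      if (n : ℤ) ∣ k then n * √q * χ (k / n : ℤ) else 0 := by
  have hq' : (q : ℂ) ≠ 0 := NeZero.ne _
  have hn' : (n : ℂ) ≠ 0 := Nat.cast_ne_zero.mpr hn
  have h1 (b a : ℕ) : χ ((q * b + a : ℕ) : ZMod q) *
      Complex.exp (2 * Real.pi * Complex.I * (q * b + a : ℕ) / (q * n : ℕ)) ^ k =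
      Complex.exp (2 * Real.pi * Complex.I * k / n) ^ b * (χ (a : ZMod q) *
        Complex.exp (2 * Real.pi * Complex.I * a / (q * n : ℕ)) ^ k) := by
    rw [← Complex.exp_int_mul, ← Complex.exp_int_mul, ← Complex.exp_nat_mul, mul_left_comm,
      ← Complex.exp_add]
    congr 2
    · simp
    · push_cast
      field_simp
  simp_rw [sum_range_mul_eq_sum_sum, h1, ← mul_sum, ← sum_mul, geom_sum_exp_eq hn]
  split_ifs with h
  · obtain ⟨l, rfl⟩ := h
    have h2 : ∑ a ∈ range q, χ (a : ZMod q) *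
        Complex.exp (2 * Real.pi * Complex.I * a / (q * n : ℕ)) ^ (n * l : ℤ) =
        gaussSum χ (ZMod.stdAddChar.mulShift (l : ZMod q)) := by
      rw [gaussSum, sum_zmod_eq_sum_range]
      refine sum_congr rfl fun a _ => ?_
      rw [AddChar.mulShift_apply, ← Int.cast_natCast a, ← Int.cast_mul, ZMod.stdAddChar_coe,
        ← Complex.exp_int_mul]
      congr 2
      push_cast
      field_simp
    have h3 : χ⁻¹ = χ := hquad.inv
    rw [h2, gaussSum_mulShift_of_isPrimitive _ hχ, h3, hχ.gaussSum_eq_sqrt hquad heven,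
      Int.mul_ediv_cancel_left _ (by exact_mod_cast hn)]
    ring
  · rw [zero_mul]

theorem ofReal_cycleHeat (m : ℕ) (t : ℝ) (j : ℕ) :
    (cycleHeat m t j : ℂ) = Complex.exp (-(2 * t)) *
      Complex.exp (t * (Complex.exp (2 * Real.pi * Complex.I * j / m) +
        (Complex.exp (2 * Real.pi * Complex.I * j / m))⁻¹)) := by
  have h1 : Complex.exp (2 * Real.pi * Complex.I * j / m) +
        (Complex.exp (2 * Real.pi * Complex.I * j / m))⁻¹ =
      ((2 - 4 * Real.sin (Real.pi * j / m) ^ 2 : ℝ) : ℂ) := by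
    rw [← Complex.exp_neg, show 2 * Real.pi * Complex.I * j / m =
      ((2 * (Real.pi * j / m) : ℝ) : ℂ) * Complex.I by push_cast; ring, ← neg_mul,
      ← Complex.two_cos, ← Complex.ofReal_cos, Real.cos_two_mul, Real.cos_sq']
    push_cast
    ring
  rw [h1, ← Complex.exp_add, cycleHeat, Complex.ofReal_exp]
  congr 1
  push_cast
  ring

theorem DirichletCharacter.IsPrimitive.hasSum_besselI {q n : ℕ} [NeZero q] (hn : n ≠ 0)
    {χ : DirichletCharacter ℂ q} (hχ : χ.IsPrimitive) (hquad : χ.IsQuadratic) (heven : χ (-1) = 1)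
    (t : ℝ) :
    HasSum (fun l : ℤ => (besselI t (n * l.natAbs) : ℂ) * (n * √q * χ l))
      (Complex.exp (2 * t) * ∑ j ∈ range (q * n), χ (j : ZMod q) * cycleHeat (q * n) t j) := by
  have h1 := hasSum_sum (s := range (q * n)) fun j _ =>
    (hasSum_besselI_mul_zpow t
      (Complex.exp_ne_zero (2 * Real.pi * Complex.I * j / (q * n : ℕ)))).mul_left (χ (j : ZMod q))
  have h2 : Complex.exp (2 * t) * ∑ j ∈ range (q * n), χ (j : ZMod q) * cycleHeat (q * n) t j =
      ∑ j ∈ range (q * n), χ (j : ZMod q) *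
        Complex.exp (t * (Complex.exp (2 * Real.pi * Complex.I * j / (q * n : ℕ)) +
        (Complex.exp (2 * Real.pi * Complex.I * j / (q * n : ℕ)))⁻¹)) := by
    rw [mul_sum]
    refine sum_congr rfl fun j _ => ?_
    rw [ofReal_cycleHeat, mul_left_comm, ← mul_assoc (Complex.exp (2 * t)), ← Complex.exp_add,
      add_neg_cancel, Complex.exp_zero, one_mul]
  have h3 : HasSum (fun k : ℤ => (besselI t k.natAbs : ℂ) *
      if (n : ℤ) ∣ k then n * √q * χ (k / n : ℤ) else 0)
      (Complex.exp (2 * t) * ∑ j ∈ range (q * n), χ (j : ZMod q) * cycleHeat (q * n) t j) := by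
    rw [h2]
    refine h1.congr_fun fun k => ?_
    rw [← hχ.sum_mul_exp_zpow hn hquad heven, mul_sum]
    exact sum_congr rfl fun j _ => mul_left_comm _ _ _
  have hinj : Function.Injective fun l : ℤ => (n : ℤ) * l :=
    mul_right_injective₀ (by exact_mod_cast hn)
  rw [← hinj.hasSum_iff] at h3
  · refine h3.congr_fun fun l => ?_
    simp [Int.natAbs_mul, hn]
  · intro k hk
    rw [if_neg, mul_zero]
    rintro ⟨l, rfl⟩
    exact hk ⟨l, rfl⟩

theorem MulChar.IsQuadratic.ofReal_re {R : Type*} [CommRing R] {χ : MulChar R ℂ}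
    (hχ : χ.IsQuadratic) (a : R) : ((χ a).re : ℂ) = χ a := by
  rcases hχ a with h | h | h <;> simp [h]

theorem MulChar.IsQuadratic.abs_re_le_one {R : Type*} [CommRing R] {χ : MulChar R ℂ}
    (hχ : χ.IsQuadratic) (a : R) : |(χ a).re| ≤ 1 := by
  rcases hχ a with h | h | h <;> simp [h]

theorem DirichletCharacter.IsPrimitive.sum_mul_cycleHeat_nonneg_of_small {q n : ℕ} (hq : 1 < q)
    (hn : 1 ≤ n) {χ : DirichletCharacter ℂ q} (hχ : χ.IsPrimitive) (hquad : χ.IsQuadratic)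
    (heven : χ (-1) = 1) {t : ℝ} (ht : 0 ≤ t) (htn : t < n ^ 2 / (2 * Real.log 2)) :
    0 ≤ ∑ j ∈ range (q * n), (χ (j : ZMod q)).re * cycleHeat (q * n) t j := by
  have : NeZero q := ⟨by omega⟩
  have : Fact (1 < q) := ⟨hq⟩
  have h0 : χ 0 = 0 := χ.map_zero
  have h1 := (hχ.hasSum_besselI (by omega : n ≠ 0) hquad heven t).nat_add_neg
  have h2 : HasSum (fun l : ℕ => 2 * (n * √q) * ((χ (l : ZMod q)).re * besselI t (n * l)))
      (Real.exp (2 * t) * ∑ j ∈ range (q * n), (χ (j : ZMod q)).re * cycleHeat (q * n) t j) := by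
    rw [← Complex.hasSum_ofReal]
    convert h1 using 1
    · ext l
      have hneg : χ (-(l : ZMod q)) = χ l := by
        rw [neg_eq_neg_one_mul, map_mul, heven, one_mul]
      simp only [Int.natAbs_neg, Int.natAbs_natCast, Int.cast_neg, Int.cast_natCast, hneg]
      push_cast
      rw [hquad.ofReal_re]
      ring
    · simp [h0, hquad.ofReal_re]
  refine nonneg_of_mul_nonneg_right (ge_of_tendsto'
    (h2.tendsto_sum_nat.comp (Filter.tendsto_add_atTop_nat 2)) fun L => ?_) (Real.exp_pos (2 * t))
  rw [Function.comp_apply, ← mul_sum, range_eq_Ico, sum_eq_sum_Ico_succ_bot (by omega),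
    sum_eq_sum_Ico_succ_bot (by omega)]
  have h3 : -∑ l ∈ Ico 2 (L + 2), besselI t (n * l) ≤
      ∑ l ∈ Ico 2 (L + 2), (χ (l : ZMod q)).re * besselI t (n * l) := by
    rw [← sum_neg_distrib]
    refine sum_le_sum fun l _ => ?_
    nlinarith [neg_le_of_abs_le (hquad.abs_re_le_one (l : ZMod q)), besselI_nonneg ht (n * l)]
  have h4 := sum_besselI_le_besselI hn ht htn L
  refine mul_nonneg (by positivity) ?_
  simp only [Nat.cast_zero, h0, zero_add, Nat.cast_one, map_one, mul_one, Complex.one_re,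
    Complex.zero_re, zero_mul, one_mul]
  norm_num at h3 ⊢
  linarith

theorem heat_positivity_ranges {q : ℕ} (hq : 1 < q)
    (χ : DirichletCharacter ℂ q) (hprim : χ.IsPrimitive) (hχ : χ (-1) = 1)
    (hreal : ∀ x : ZMod q, (χ x).im = 0)
    (n : ℕ) (hn : 1 ≤ n) (t : ℝ) (ht : 0 < t)
    (hrange : t < n ^ 2 / (2 * Real.log 2) ∨
      t > q ^ 2 * n ^ 2 * Real.log 2 / (4 * (16 - Real.pi ^ 2))) :
    ∃ r : ℝ, 0 ≤ r ∧
      ∑ j ∈ Finset.Ico 1 (q * n),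
        χ (j : ZMod q) *
          (Real.exp (-(4 * t * Real.sin (Real.pi * j / (q * n)) ^ 2)) : ℂ) = (r : ℂ) := by
  have : NeZero q := ⟨by omega⟩
  have : Fact (1 < q) := ⟨hq⟩
  have hquad : χ.IsQuadratic := MulChar.isQuadratic_of_im_eq_zero hreal
  have hqn : 2 ≤ q * n := by nlinarith
  refine ⟨∑ j ∈ Ico 1 (q * n), (χ (j : ZMod q)).re * cycleHeat (q * n) t j, ?_, ?_⟩
  · rcases hrange with h | h
    · have := hprim.sum_mul_cycleHeat_nonneg_of_small hq hn hquad hχ ht.le h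
      rw [range_eq_Ico, sum_eq_sum_Ico_succ_bot (by omega)] at this
      simpa [χ.map_zero] using this
    · refine sum_mul_cycleHeat_nonneg_of_large hqn (f := fun j => (χ (j : ZMod q)).re)
        (fun j => hquad.abs_re_le_one _) (by simp) ?_ ?_
      · simp [Nat.cast_sub (by omega : 1 ≤ q * n), hχ]
      · rwa [Nat.cast_mul, mul_pow]
  · rw [Complex.ofReal_sum]
    refine sum_congr rfl fun j _ => ?_
    rw [Complex.ofReal_mul, hquad.ofReal_re, cycleHeat, Nat.cast_mul]
end

section
/- For every integer n ≥ 1, every real θ, and every complex number x, T_n(1 − 2x) − cos(2πθ) = (1/2)·∏_{j=0}^{n−1} (4 sin²(π(j+θ)/n) − 4x), where T_n is the n-th Chebyshev polynomial of the first kind evaluated at 1 − 2x. -/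
open Finset Polynomial

/-- The evaluation of `X_pow_sub_C_eq_prod` at `z`. -/
lemma prod_range_sub_pow_mul {R : Type*} [CommRing R] [IsDomain R] {n : ℕ} (hn : 0 < n) {ζ : R}
    (hζ : IsPrimitiveRoot ζ n) (z a : R) :
    ∏ j ∈ Finset.range n, (z - ζ ^ j * a) = z ^ n - a ^ n := by
  have h := congrArg (Polynomial.eval z) (X_pow_sub_C_eq_prod hζ hn (rfl : a ^ n = a ^ n))
  simpa [eval_prod] using h.symm

lemma two_cos_sub_two_cos (w φ : ℂ) :
    2 * Complex.cos w - 2 * Complex.cos φ =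
      Complex.exp (-(w * Complex.I)) *
        ((Complex.exp (w * Complex.I) - Complex.exp (φ * Complex.I)) *
          (Complex.exp (w * Complex.I) - Complex.exp (-(φ * Complex.I)))) := by
  have hz := Complex.exp_ne_zero (w * Complex.I)
  have ha := Complex.exp_ne_zero (φ * Complex.I)
  rw [Complex.cos, Complex.cos, neg_mul, neg_mul, Complex.exp_neg, Complex.exp_neg]
  field_simp
  ring

/-- The product of `2 cos w - 2 cos` over `n` equally spaced angles. -/
lemma prod_range_two_cos_sub_two_cos {n : ℕ} (hn : 0 < n) (w θ : ℂ) :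
    ∏ j ∈ Finset.range n,
        (2 * Complex.cos w - 2 * Complex.cos (2 * Real.pi * (j + θ) / n)) =
      2 * Complex.cos (n * w) - 2 * Complex.cos (2 * Real.pi * θ) := by
  have hn' : (n : ℂ) ≠ 0 := by exact_mod_cast hn.ne'
  have hζ := Complex.isPrimitiveRoot_exp n hn.ne'
  have e₁ : ∀ j : ℕ, Complex.exp (2 * Real.pi * (j + θ) / n * Complex.I) =
      Complex.exp (2 * Real.pi * Complex.I / n) ^ j *
        Complex.exp (2 * Real.pi * θ / n * Complex.I) := fun j ↦ by
    rw [← Complex.exp_nat_mul, ← Complex.exp_add]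
    congr 1
    ring
  have e₂ : ∀ j : ℕ, Complex.exp (-(2 * Real.pi * (j + θ) / n * Complex.I)) =
      (Complex.exp (2 * Real.pi * Complex.I / n))⁻¹ ^ j *
        Complex.exp (-(2 * Real.pi * θ / n * Complex.I)) := fun j ↦ by
    rw [Complex.exp_neg, e₁, mul_inv, inv_pow, Complex.exp_neg]
  simp_rw [two_cos_sub_two_cos, e₁, e₂]
  rw [Finset.prod_mul_distrib, Finset.prod_mul_distrib, prod_range_sub_pow_mul hn hζ,
    prod_range_sub_pow_mul hn hζ.inv, Finset.prod_const, Finset.card_range]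
  have e₃ : (n : ℂ) * (2 * Real.pi * θ / n * Complex.I) = 2 * Real.pi * θ * Complex.I := by
    field_simp
  simp_rw [← Complex.exp_nat_mul, mul_neg, e₃, mul_assoc]

theorem chebyshev_characteristic_polynomial (n : ℕ) (hn : 1 ≤ n) (θ : ℝ) (x : ℂ) :
    (Polynomial.Chebyshev.T ℂ n).eval (1 - 2 * x) - (Real.cos (2 * Real.pi * θ) : ℂ) =
      (1 / 2) * ∏ j ∈ Finset.range n,
        (((4 * Real.sin (Real.pi * (j + θ) / n) ^ 2 : ℝ) : ℂ) - 4 * x) := by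
  obtain ⟨w, hw⟩ := Complex.cos_surjective (1 - 2 * x)
  have h : ∀ j : ℕ, ((4 * Real.sin (Real.pi * (j + θ) / n) ^ 2 : ℝ) : ℂ) - 4 * x =
      2 * Complex.cos w - 2 * Complex.cos (2 * Real.pi * (j + θ) / n) := fun j ↦ by
    have hφ : (2 * Real.pi * (j + θ) / n : ℂ) = 2 * (Real.pi * (j + θ) / n) := by ring
    rw [hw, hφ, Complex.cos_two_mul, Complex.cos_sq']
    push_cast
    ring
  simp_rw [h]
  rw [prod_range_two_cos_sub_two_cos hn, ← hw, Polynomial.Chebyshev.T_complex_cos]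
  push_cast
  ring
end

section
/- Let n ≥ 1 be an integer, θ a real number, and s a complex number such that 4 sin²(π(j+θ)/n) ≠ s for every j = 0, …, n−1. Then ∑_{j=0}^{n−1} 1/(4 sin²(π(j+θ)/n) − s) = (1/2) · n · U_{n−1}(1 − s/2) / (T_n(1 − s/2) − cos(2πθ)), and in particular T_n(1 − s/2) − cos(2πθ) ≠ 0. -/
open Finset Polynomial

/-- With `u = exp (i z)`, both sides are `(uⁿ - c) (uⁿ - c⁻¹) / uⁿ`, where `c = exp (2 π i θ)`. -/
theorem prod_two_mul_cos_sub_cos (n : ℕ) (hn : 0 < n) (θ z : ℂ) :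
    ∏ j ∈ range n, (2 * (Complex.cos z - Complex.cos (2 * Real.pi * (j + θ) / n))) =
      2 * (Complex.cos (n * z) - Complex.cos (2 * Real.pi * θ)) := by
  have hn0 : (n : ℂ) ≠ 0 := by exact_mod_cast hn.ne'
  have hζ : IsPrimitiveRoot (Complex.exp (2 * Real.pi * Complex.I / n)) n :=
    Complex.isPrimitiveRoot_exp n hn.ne'
  have key (ξ α u : ℂ) (hξ : IsPrimitiveRoot ξ n) :
      ∏ j ∈ range n, (u - ξ ^ j * α) = u ^ n - α ^ n := by
    have := congrArg (eval u) (X_pow_sub_C_eq_prod hξ hn (rfl : α ^ n = α ^ n))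
    simpa [eval_prod] using this.symm
  have hu : ∏ j ∈ range n, (2 * (Complex.cos z - Complex.cos (2 * Real.pi * (j + θ) / n))) =
      (∏ j ∈ range n, (Complex.exp (z * Complex.I) -
        Complex.exp (2 * Real.pi * Complex.I / n) ^ j *
          Complex.exp (2 * Real.pi * θ / n * Complex.I))) *
      (∏ j ∈ range n, (Complex.exp (z * Complex.I) -
        (Complex.exp (2 * Real.pi * Complex.I / n))⁻¹ ^ j *
          Complex.exp (-(2 * Real.pi * θ / n * Complex.I)))) *
      Complex.exp (-(z * Complex.I)) ^ n := by
    rw [← prod_mul_distrib]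
    conv_rhs => rw [← card_range n, ← prod_const, card_range, ← prod_mul_distrib]
    refine prod_congr rfl fun j _ => ?_
    simp only [← Complex.exp_neg, ← Complex.exp_nat_mul, ← Complex.exp_add, Complex.cos]
    have h1 : (j : ℂ) * (2 * Real.pi * Complex.I / n) + 2 * Real.pi * θ / n * Complex.I =
        2 * Real.pi * (j + θ) / n * Complex.I := by ring
    have h2 : (j : ℂ) * -(2 * Real.pi * Complex.I / n) + -(2 * Real.pi * θ / n * Complex.I) =
        -(2 * Real.pi * (j + θ) / n * Complex.I) := by ring
    rw [h1, h2, neg_mul, neg_mul]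
    simp only [Complex.exp_neg]
    field_simp [Complex.exp_ne_zero]
    ring
  rw [hu, key _ _ _ hζ, key _ _ _ hζ.inv]
  simp only [← Complex.exp_nat_mul, Complex.cos]
  have h1 : (n : ℂ) * (2 * Real.pi * θ / n * Complex.I) = 2 * Real.pi * θ * Complex.I := by
    field_simp
  rw [mul_neg, mul_neg, h1, neg_mul, neg_mul, mul_assoc (n : ℂ)]
  simp only [Complex.exp_neg]
  field_simp [Complex.exp_ne_zero]
  ring

theorem prod_two_mul_sub_cos_eq_eval_chebyshev_T (n : ℕ) (hn : 0 < n) (θ x : ℂ) :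
    ∏ j ∈ range n, (2 * (x - Complex.cos (2 * Real.pi * (j + θ) / n))) =
      2 * ((Chebyshev.T ℂ n).eval x - Complex.cos (2 * Real.pi * θ)) := by
  obtain ⟨z, rfl⟩ := Complex.cos_surjective x
  rw [prod_two_mul_cos_sub_cos n hn, Chebyshev.T_complex_cos]
  norm_cast

theorem laplace_transform_heat_trace_cycle (n : ℕ) (hn : 1 ≤ n) (θ : ℝ) (s : ℂ)
    (hs : ∀ j ∈ Finset.range n, ((4 * Real.sin (Real.pi * (j + θ) / n) ^ 2 : ℝ) : ℂ) ≠ s) :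
    (∑ j ∈ Finset.range n,
        1 / (((4 * Real.sin (Real.pi * (j + θ) / n) ^ 2 : ℝ) : ℂ) - s) =
      (1 / 2) * n * (Polynomial.Chebyshev.U ℂ ((n : ℤ) - 1)).eval (1 - s / 2) /
        ((Polynomial.Chebyshev.T ℂ n).eval (1 - s / 2) - (Real.cos (2 * Real.pi * θ) : ℂ))) ∧
    (Polynomial.Chebyshev.T ℂ n).eval (1 - s / 2) - (Real.cos (2 * Real.pi * θ) : ℂ) ≠ 0 := by
  have hfactor (j : ℕ) : ((4 * Real.sin (Real.pi * (j + θ) / n) ^ 2 : ℝ) : ℂ) - s =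
      2 * ((1 - s / 2) - Complex.cos (2 * Real.pi * (j + θ) / n)) := by
    have h : (2 * Real.pi * (j + θ) / n : ℂ) = 2 * (Real.pi * (j + θ) / n) := by ring
    rw [h, Complex.cos_two_mul, Complex.cos_sq']
    push_cast
    ring
  have hne : ∀ j ∈ range n,
      2 * ((1 - s / 2) - Complex.cos (2 * Real.pi * (j + θ) / n)) ≠ 0 := fun j hj => by
    rw [← hfactor]
    exact sub_ne_zero.2 (hs j hj)
  have hprod := prod_two_mul_sub_cos_eq_eval_chebyshev_T n hn θ
  have hcos : ((Real.cos (2 * Real.pi * θ) : ℝ) : ℂ) = Complex.cos (2 * Real.pi * θ) := by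
    push_cast
    rfl
  have hT : (Chebyshev.T ℂ n).eval (1 - s / 2) - Complex.cos (2 * Real.pi * θ) ≠ 0 :=
    right_ne_zero_of_mul (hprod (1 - s / 2) ▸ prod_ne_zero_iff.2 hne)
  rw [hcos]
  refine ⟨?_, hT⟩
  have hlog := logDeriv_prod (s := range n)
    (f := fun (j : ℕ) (x : ℂ) => 2 * (x - Complex.cos (2 * Real.pi * (j + θ) / n)))
    (x := 1 - s / 2) hne (fun _ _ => by fun_prop)
  simp only [hprod] at hlog
  simp only [logDeriv_apply, deriv_const_mul_field, deriv_sub_const, Polynomial.deriv,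
    Chebyshev.T_derivative_eq_U, deriv_id'', mul_one, eval_mul, eval_natCast,
    Int.cast_natCast] at hlog
  simp only [hfactor]
  rw [mul_div_mul_left _ _ two_ne_zero] at hlog
  rw [mul_assoc, mul_div_assoc, hlog, mul_sum]
  exact sum_congr rfl fun j _ => by ring
end

section
/- Let 0 < θ < 1 be real and let p ≥ 1 be an integer. Then the map n ↦ ζ_n(p,θ) is a polynomial function of n: there exists a polynomial P with real coefficients such that for every integer n ≥ 1, ∑_{j=0}^{n−1} (4 sin²(π(j+θ)/n))^{−p} = P(n). -/
open Finset

open Polynomial in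
/-- If all elementary symmetric functions of `u n 0, …, u n (n - 1)` are polynomial in `n`, then so
are the power sums. -/
theorem exists_polynomial_sum_pow_of_esymm {K : Type*} [Field K] (u : (n : ℕ) → Fin n → K)
    (h : ∀ k, ∃ Q : K[X], ∀ n : ℕ, 1 ≤ n →
      MvPolynomial.aeval (u n) (MvPolynomial.esymm (Fin n) K k) = Q.eval (n : K)) (k : ℕ) :
    ∃ Q : K[X], ∀ n : ℕ, 1 ≤ n → ∑ j, u n j ^ k = Q.eval (n : K) := by
  choose E hE using h
  induction k using Nat.strong_induction_on with
  | _ k ih =>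
    rcases Nat.eq_zero_or_pos k with rfl | hk
    · exact ⟨X, fun n _ => by simp⟩
    have ih' : ∀ m, ∃ Q : K[X], m < k → ∀ n : ℕ, 1 ≤ n →
        ∑ j, u n j ^ m = Q.eval (n : K) := fun m => by
      by_cases hm : m < k
      · obtain ⟨Q, hQ⟩ := ih m hm
        exact ⟨Q, fun _ => hQ⟩
      · exact ⟨0, fun h => absurd h hm⟩
    choose S hS using ih'
    refine ⟨(-1) ^ (k + 1) * k * E k - ∑ a ∈ antidiagonal k with a.1 ∈ Set.Ioo 0 k,
      (-1) ^ a.1 * E a.1 * S a.2, fun n hn => ?_⟩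
    have key := congrArg (MvPolynomial.aeval (u n))
      (MvPolynomial.psum_eq_mul_esymm_sub_sum (Fin n) K k hk)
    have hp : ∀ m, MvPolynomial.aeval (u n) (MvPolynomial.psum (Fin n) K m) = ∑ j, u n j ^ m :=
      fun m => by simp [MvPolynomial.psum]
    simp only [map_sub, map_mul, map_sum, map_pow, map_neg, map_one, map_natCast, hp,
      hE _ n hn] at key
    rw [key]
    simp only [eval_sub, eval_mul, eval_finsetSum, eval_pow, eval_neg, eval_one, eval_natCast]
    congr 1
    refine Finset.sum_congr rfl fun a ha => ?_
    simp only [mem_filter, HasAntidiagonal.mem_antidiagonal, Set.mem_Ioo] at ha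
    rw [hS a.2 (by omega) n hn]

open Polynomial in
theorem coeff_prod_one_add_C_mul_X {σ R : Type*} [Fintype σ] [CommRing R] (u : σ → R) (k : ℕ) :
    (∏ j, (1 + C (u j) * X)).coeff k = MvPolynomial.aeval u (MvPolynomial.esymm σ R k) := by
  simp only [Finset.prod_one_add, finsetSum_coeff, Finset.prod_mul_distrib, Finset.prod_const,
    ← map_prod, coeff_C_mul_X_pow, MvPolynomial.esymm, map_sum,
    Finset.powersetCard_eq_filter, Finset.sum_filter, eq_comm (a := k)]
  simp [apply_ite (MvPolynomial.eval u)]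

open Polynomial in
/-- If `z n 0, …, z n (n - 1)` are the roots of `X ^ n - w`, then the elementary symmetric functions
of the numbers `1 / (1 - z n j)` are polynomial in `n`. -/
theorem exists_polynomial_esymm_inv_one_sub {K : Type*} [Field K] [CharZero K] {w : K}
    (hw : w ≠ 1) (z : (n : ℕ) → Fin n → K)
    (hz : ∀ n : ℕ, 1 ≤ n → X ^ n - C w = ∏ j, (X - C (z n j))) (k : ℕ) :
    ∃ Q : K[X], ∀ n : ℕ, 1 ≤ n →
      MvPolynomial.aeval (fun j => (1 - z n j)⁻¹) (MvPolynomial.esymm (Fin n) K k) =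
        Q.eval (n : K) := by
  rcases Nat.eq_zero_or_pos k with rfl | hk
  · exact ⟨1, fun n _ => by simp⟩
  have hw' : 1 - w ≠ 0 := sub_ne_zero.mpr hw.symm
  refine ⟨C ((1 - w)⁻¹ * (k.factorial : K)⁻¹) * descPochhammer K k, fun n hn => ?_⟩
  have h1 : 1 - w = ∏ j, (1 - z n j) := by
    simpa [eval_prod] using congrArg (eval 1) (hz n hn)
  have hne : ∀ j, 1 - z n j ≠ 0 := fun j => by
    rw [h1] at hw'
    exact Finset.prod_ne_zero_iff.mp hw' j (mem_univ j)
  have h2 : C (1 - w) * ∏ j, (1 + C ((1 - z n j)⁻¹) * X) = (1 + X) ^ n - C w := by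
    have h3 : (1 + X) ^ n - C w = ∏ j, (1 + X - C (z n j)) := by
      have h := congrArg (fun q => q.comp (1 + X)) (hz n hn)
      simp only [Polynomial.prod_comp, sub_comp, X_pow_comp, X_comp, C_comp] at h
      exact h
    rw [h3, h1, map_prod, ← Finset.prod_mul_distrib]
    refine Finset.prod_congr rfl fun j _ => ?_
    rw [mul_add, ← mul_assoc, ← C_mul, mul_inv_cancel₀ (hne j)]
    simp only [C_sub, C_1]
    ring
  have h4 := congrArg (fun q => q.coeff k) h2
  simp only [coeff_C_mul, coeff_prod_one_add_C_mul_X, coeff_sub, coeff_one_add_X_pow, coeff_C,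
    hk.ne', if_false, sub_zero] at h4
  rw [eval_mul, eval_C, descPochhammer_eval_eq_descFactorial,
    Nat.descFactorial_eq_factorial_mul_choose, Nat.cast_mul, mul_assoc, inv_mul_cancel_left₀ (by exact_mod_cast k.factorial_ne_zero), ← h4,
    inv_mul_cancel_left₀ hw']

open Polynomial in
theorem X_pow_sub_C_exp_eq_prod (θ : ℝ) {n : ℕ} (hn : 1 ≤ n) :
    X ^ n - C (Complex.exp (2 * Real.pi * Complex.I * θ)) =
      ∏ j : Fin n, (X - C (Complex.exp (2 * Real.pi * Complex.I * (j + θ) / n))) := by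
  have hn0 : (n : ℂ) ≠ 0 := by exact_mod_cast (by omega : n ≠ 0)
  have hα : Complex.exp (2 * Real.pi * Complex.I * θ / n) ^ n =
      Complex.exp (2 * Real.pi * Complex.I * θ) := by
    rw [← Complex.exp_nat_mul]
    congr 1
    field_simp
  rw [X_pow_sub_C_eq_prod (Complex.isPrimitiveRoot_exp n (by omega)) hn hα, Finset.prod_range]
  refine Finset.prod_congr rfl fun j _ => ?_
  rw [← Complex.exp_nat_mul, ← Complex.exp_add]
  congr 3
  field_simp

theorem exp_two_pi_mul_I_mul_ne_one {θ : ℝ} (hθ0 : 0 < θ) (hθ1 : θ < 1) :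
    Complex.exp (2 * Real.pi * Complex.I * θ) ≠ 1 := by
  rw [Ne, Complex.exp_eq_one_iff]
  rintro ⟨m, hm⟩
  have h : (θ : ℂ) = m := by
    apply mul_left_cancel₀ Complex.two_pi_I_ne_zero
    rw [hm, mul_comm]
  have h' : θ = m := by exact_mod_cast h
  rw [h'] at hθ0 hθ1
  have h0 : 0 < m := by exact_mod_cast hθ0
  have h1 : m < 1 := by exact_mod_cast hθ1
  omega

theorem inv_four_mul_sin_sq (y : ℂ) :
    (4 * Complex.sin y ^ 2)⁻¹ =
      (1 - Complex.exp (2 * Complex.I * y))⁻¹ - (1 - Complex.exp (2 * Complex.I * y))⁻¹ ^ 2 := by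
  have he : Complex.exp (y * Complex.I) ≠ 0 := Complex.exp_ne_zero _
  have h2 : Complex.exp (2 * Complex.I * y) = Complex.exp (y * Complex.I) ^ 2 := by
    rw [← Complex.exp_nat_mul]
    congr 1
    push_cast
    ring
  rw [h2, Complex.sin, neg_mul, Complex.exp_neg]
  generalize Complex.exp (y * Complex.I) = e at he
  have h3 : 4 * ((e⁻¹ - e) * Complex.I / 2) ^ 2 = -((1 - e ^ 2) ^ 2 / e ^ 2) := by
    field_simp
    rw [Complex.I_sq]
    ring
  rw [h3]
  by_cases h : 1 - e ^ 2 = 0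
  · simp [h]
  · field_simp
    ring

open Polynomial in
theorem eval_ofReal_re (Q : ℂ[X]) :
    ∃ P : ℝ[X], ∀ x : ℝ, (Q.eval (x : ℂ)).re = P.eval x := by
  refine ⟨∑ i ∈ range (Q.natDegree + 1), C (Q.coeff i).re * X ^ i, fun x => ?_⟩
  rw [eval_eq_sum_range, Complex.re_sum, eval_finsetSum]
  refine Finset.sum_congr rfl fun i _ => ?_
  rw [← Complex.ofReal_pow, Complex.re_mul_ofReal]
  simp

theorem zeta_discrete_polynomial_in_n (θ : ℝ) (hθ0 : 0 < θ) (hθ1 : θ < 1)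
    (p : ℕ) (hp : 1 ≤ p) :
    ∃ P : Polynomial ℝ, ∀ n : ℕ, 1 ≤ n →
      ∑ j ∈ Finset.range n, (4 * Real.sin (Real.pi * (j + θ) / n) ^ 2) ^ (-(p : ℤ)) =
        P.eval (n : ℝ) := by
  let u (n : ℕ) (j : Fin n) : ℂ :=
    (1 - Complex.exp (2 * Real.pi * Complex.I * (j + θ) / n))⁻¹
  choose S hS using exists_polynomial_sum_pow_of_esymm u
    (exists_polynomial_esymm_inv_one_sub (exp_two_pi_mul_I_mul_ne_one hθ0 hθ1)
      (fun n j => Complex.exp (2 * Real.pi * Complex.I * (j + θ) / n))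
      fun n hn => X_pow_sub_C_exp_eq_prod θ hn)
  let q : Polynomial ℂ := (Polynomial.X - Polynomial.X ^ 2) ^ p
  obtain ⟨P, hP⟩ := eval_ofReal_re
    (∑ i ∈ range (q.natDegree + 1), Polynomial.C (q.coeff i) * S i)
  refine ⟨P, fun n hn => ?_⟩
  rw [← hP, ← Complex.ofReal_re (∑ j ∈ Finset.range n, _)]
  congr 1
  have hterm : ∀ j : Fin n,
      (((4 * Real.sin (Real.pi * (j + θ) / n) ^ 2) ^ (-(p : ℤ)) : ℝ) : ℂ) = q.eval (u n j) := by
    intro j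
    have h := inv_four_mul_sin_sq (Real.pi * (j + θ) / n)
    rw [show 2 * Complex.I * (Real.pi * (j + θ) / n : ℂ) =
      2 * Real.pi * Complex.I * (j + θ) / n by ring] at h
    simp only [q, u, Polynomial.eval_pow, Polynomial.eval_sub, Polynomial.eval_X]
    rw [← h, zpow_neg, zpow_natCast, inv_pow]
    push_cast
    rfl
  rw [Finset.sum_range, Complex.ofReal_sum, Finset.sum_congr rfl fun j _ => hterm j]
  simp only [Polynomial.eval_eq_sum_range (p := q), Polynomial.eval_finsetSum, Polynomial.eval_mul,
    Polynomial.eval_C, Complex.ofReal_natCast, ← hS _ n hn, Finset.mul_sum]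
  exact Finset.sum_comm
end
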